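/- Let ℓ = 3, H ∈ A, and assume A' := A \ {H} is not free. Then A is free with exponents (1, a, b) if and only if A' is strictly plus-one generated with POexp(A') = (1, a, b) and level d = |A'| − |A^H|. Moreover, the equality d = |A'| − |A^H| is equivalent to b_2(A) = ab + a + b. -/

import Mathlib

open MvPolynomial

noncomputable section

attribute [local instance] Classical.propDecidable

namespace ArrPOG

variable (K : Type) [Field K] (ℓ : ℕ)

/-- A polynomial vector field on `K^ℓ`: `θ = Σ θᵢ ∂/∂xᵢ`, identified with its
coefficient vector `(θ₁,…,θ_ℓ)` in `S = K[x₁,…,x_ℓ]`. -/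
abbrev Deriv : Type := Fin ℓ → MvPolynomial (Fin ℓ) K

variable {K ℓ}

/-- The linear polynomial `α_H ∈ S` associated to a linear form `φ ∈ V*`. -/
def linPoly (φ : Module.Dual K (Fin ℓ → K)) : MvPolynomial (Fin ℓ) K :=
  ∑ i, MvPolynomial.C (φ (Pi.single i 1)) * MvPolynomial.X i

/-- `θ(α)` for a derivation `θ` and the linear form `α` given by `φ ∈ V*`. -/
def applyLin (θ : Deriv K ℓ) (φ : Module.Dual K (Fin ℓ → K)) : MvPolynomial (Fin ℓ) K :=
  ∑ i, MvPolynomial.C (φ (Pi.single i 1)) * θ i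

/-- An arrangement: a finite set of hyperplanes (kernels of nonzero linear forms). -/
def IsArrangement (A : Finset (Submodule K (Fin ℓ → K))) : Prop :=
  ∀ H ∈ A, ∃ φ : Module.Dual K (Fin ℓ → K), φ ≠ 0 ∧ LinearMap.ker φ = H

/-- Essential: the common intersection of all members is `0`. -/
def Essential (A : Finset (Submodule K (Fin ℓ → K))) : Prop :=
  A.inf id = ⊥

/-- Membership in the logarithmic derivation module `D(A)`:
`θ(α_H) ∈ S·α_H` for every `H ∈ A`. -/
def InD (A : Finset (Submodule K (Fin ℓ → K))) (θ : Deriv K ℓ) : Prop :=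
  ∀ H ∈ A, ∀ φ : Module.Dual K (Fin ℓ → K), LinearMap.ker φ = H → linPoly φ ∣ applyLin θ φ

/-- A derivation is homogeneous of degree `n` if all its coefficients are. -/
def HomogDeriv (θ : Deriv K ℓ) (n : ℕ) : Prop := ∀ i, (θ i).IsHomogeneous n

/-- `θ₁,…,θₙ` generate `D(A)` as an `S`-module. -/
def GeneratesD {n : ℕ} (A : Finset (Submodule K (Fin ℓ → K))) (θ : Fin n → Deriv K ℓ) : Prop :=
  (∀ i, InD A (θ i)) ∧
    ∀ η, InD A η → ∃ c : Fin n → MvPolynomial (Fin ℓ) K, η = ∑ i, c i • θ i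

/-- `S`-linear independence of a family of derivations. -/
def IndepD {n : ℕ} (θ : Fin n → Deriv K ℓ) : Prop :=
  ∀ c : Fin n → MvPolynomial (Fin ℓ) K, (∑ i, c i • θ i) = 0 → ∀ i, c i = 0

/-- `A` is free with exponents `e`: `D(A)` has a homogeneous basis of degrees `e i`. -/
def IsFreeExp (A : Finset (Submodule K (Fin ℓ → K))) (e : Fin ℓ → ℕ) : Prop :=
  ∃ θ : Fin ℓ → Deriv K ℓ, (∀ i, HomogDeriv (θ i) (e i)) ∧ GeneratesD A θ ∧ IndepD θ

/-- `A` is free. -/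
def IsFree (A : Finset (Submodule K (Fin ℓ → K))) : Prop := ∃ e, IsFreeExp A e

/-- `A` is plus-one generated with exponents `e`, level `lev`, realized by the minimal
homogeneous generators `θ₁,…,θ_ℓ, φ` whose unique syzygy is `Σ fᵢ•θᵢ + α•φ = 0`:
this encodes the minimal free resolution
`0 → S[-lev-1] → S[-lev] ⊕ (⊕ S[-eᵢ]) → D(A) → 0`. -/
def IsPOGWith (A : Finset (Submodule K (Fin ℓ → K))) (e : Fin ℓ → ℕ) (lev : ℕ)
    (θ : Fin ℓ → Deriv K ℓ) (φ : Deriv K ℓ)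
    (f : Fin ℓ → MvPolynomial (Fin ℓ) K) (α : MvPolynomial (Fin ℓ) K) : Prop :=
  (∀ i, InD A (θ i)) ∧ InD A φ ∧
  (∀ i, HomogDeriv (θ i) (e i)) ∧ HomogDeriv φ lev ∧
  (∀ η, InD A η → ∃ (c : Fin ℓ → MvPolynomial (Fin ℓ) K) (g : MvPolynomial (Fin ℓ) K),
      η = (∑ i, c i • θ i) + g • φ) ∧
  α.IsHomogeneous 1 ∧
  (∀ i, (f i).IsHomogeneous (lev + 1 - e i)) ∧
  (∀ i, MvPolynomial.constantCoeff (f i) = 0) ∧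
  ((∑ i, f i • θ i) + α • φ = 0) ∧
  (¬ (α = 0 ∧ ∀ i, f i = 0)) ∧
  (∀ (g : Fin ℓ → MvPolynomial (Fin ℓ) K) (h : MvPolynomial (Fin ℓ) K),
      ((∑ i, g i • θ i) + h • φ = 0) →
      ∃ q : MvPolynomial (Fin ℓ) K, (∀ i, g i = q * f i) ∧ h = q * α)

/-- Plus-one generated with exponents `e` and level `lev`. -/
def IsPOG (A : Finset (Submodule K (Fin ℓ → K))) (e : Fin ℓ → ℕ) (lev : ℕ) : Prop :=
  ∃ θ φ f α, IsPOGWith A e lev θ φ f α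

/-- Strictly plus-one generated: the level coefficient `α` is nonzero. -/
def IsSPOG (A : Finset (Submodule K (Fin ℓ → K))) (e : Fin ℓ → ℕ) (lev : ℕ) : Prop :=
  ∃ θ φ f α, IsPOGWith A e lev θ φ f α ∧ α ≠ 0

/-- The restriction `A^H = {L ⊓ H | L ∈ A \ {H}}`. -/
def restrict (A : Finset (Submodule K (Fin ℓ → K))) (H : Submodule K (Fin ℓ → K)) :
    Finset (Submodule K (Fin ℓ → K)) :=
  (A.erase H).image (fun L => L ⊓ H)

/-- The localization `A_X = {L ∈ A | X ⊆ L}`. -/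
def localize (A : Finset (Submodule K (Fin ℓ → K))) (X : Submodule K (Fin ℓ → K)) :
    Finset (Submodule K (Fin ℓ → K)) :=
  A.filter (fun L => X ≤ L)

/-- The intersection lattice of `A`, inside the ambient space `T`. -/
def latticeOf (T : Submodule K (Fin ℓ → K)) (A : Finset (Submodule K (Fin ℓ → K))) :
    Finset (Submodule K (Fin ℓ → K)) :=
  A.powerset.image (fun B => T ⊓ B.inf id)

/-- The Möbius function of the poset `L` (intersection lattice with top `T`). -/
def mob (T : Submodule K (Fin ℓ → K)) (L : Finset (Submodule K (Fin ℓ → K)))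
    (X : Submodule K (Fin ℓ → K)) : ℤ :=
  if X = T then 1
  else - ∑ Y ∈ (L.filter fun Z => X < Z).attach, mob T L Y.1
termination_by (L.filter fun Z => X < Z).card
decreasing_by
  obtain ⟨Y, hY⟩ := Y
  simp only [Finset.mem_filter] at hY
  apply Finset.card_lt_card
  rw [Finset.ssubset_def]
  constructor
  · intro Z hZ
    simp only [Finset.mem_filter] at hZ ⊢
    exact ⟨hZ.1, lt_trans hY.2 hZ.2⟩
  · intro hsub
    have h2 := hsub (Finset.mem_filter.mpr ⟨hY.1, hY.2⟩)
    simp only [Finset.mem_filter] at h2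
    exact lt_irrefl Y h2.2

/-- The characteristic polynomial `χ(A;t) = Σ_{X ∈ L(A)} μ(X) t^{dim X}`
of an arrangement inside the ambient space `T`. -/
def charPoly (T : Submodule K (Fin ℓ → K)) (A : Finset (Submodule K (Fin ℓ → K))) :
    Polynomial ℤ :=
  ∑ X ∈ latticeOf T A,
    Polynomial.C (mob T (latticeOf T A) X) * Polynomial.X ^ (Module.finrank K X)

/-- The Betti number `b_i(A)`: `χ(A;t) = Σ (-1)^i b_i(A) t^{ℓ-i}`. -/
def bNum (A : Finset (Submodule K (Fin ℓ → K))) (i : ℕ) : ℤ :=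
  (-1) ^ i * (charPoly (⊤ : Submodule K (Fin ℓ → K)) A).coeff (ℓ - i)

/-- Evaluation of the Poincaré polynomial `π(A;t) = Σ μ(X) (-t)^{codim X}` at `t : ℚ`. -/
def poincareEval (A : Finset (Submodule K (Fin ℓ → K))) (t : ℚ) : ℚ :=
  ∑ X ∈ latticeOf ⊤ A,
    (mob (⊤ : Submodule K (Fin ℓ → K)) (latticeOf ⊤ A) X : ℚ) *
      (-t) ^ (ℓ - Module.finrank K X)

/-- The Euler derivation `θ_E = Σ xᵢ ∂/∂xᵢ`. -/
def eulerD : Deriv K ℓ := fun i => MvPolynomial.X i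

/-- `A` is locally free: `A_X` is free for every `X ∈ L(A)` other than `∩_{H∈A} H`. -/
def LocallyFree (A : Finset (Submodule K (Fin ℓ → K))) : Prop :=
  ∀ X ∈ latticeOf ⊤ A, X ≠ A.inf id → IsFree (localize A X)

/-- Transport a finite set of subspaces contained in `T` to `K^m` along a linear
isomorphism `T ≃ K^m`. -/
def transport {m : ℕ} (T : Submodule K (Fin ℓ → K)) (eqv : T ≃ₗ[K] (Fin m → K))
    (A : Finset (Submodule K (Fin ℓ → K))) : Finset (Submodule K (Fin m → K)) :=
  A.image fun L => (L.comap T.subtype).map eqv.toLinearMap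

/-- An arrangement inside the subspace `T` is free with exponents `e`, i.e. it is free
after identifying `T` with a coordinate space. -/
def RestrFreeExp {m : ℕ} (T : Submodule K (Fin ℓ → K))
    (A : Finset (Submodule K (Fin ℓ → K))) (e : Fin m → ℕ) : Prop :=
  ∃ eqv : T ≃ₗ[K] (Fin m → K), IsFreeExp (transport T eqv A) e

/-- The multiset of exponents. -/
def expMS {n : ℕ} (e : Fin n → ℕ) : Multiset ℕ := Finset.univ.val.map e

/-- `D(A)` has projective dimension at most 1: some finite generating set has a free
(possibly zero) syzygy module, i.e. there is a free resolution
`0 → S^m → S^n → D(A) → 0`. -/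
def PdimLEOne (A : Finset (Submodule K (Fin ℓ → K))) : Prop :=
  ∃ (n m : ℕ) (θ : Fin n → Deriv K ℓ) (r : Fin m → Fin n → MvPolynomial (Fin ℓ) K),
    GeneratesD A θ ∧
    (∀ j, (∑ i, r j i • θ i) = 0) ∧
    (∀ c : Fin n → MvPolynomial (Fin ℓ) K, (∑ i, c i • θ i) = 0 →
      ∃ q : Fin m → MvPolynomial (Fin ℓ) K, ∀ i, c i = ∑ j, q j * r j i) ∧
    (∀ q : Fin m → MvPolynomial (Fin ℓ) K, (∀ i, (∑ j, q j * r j i) = 0) → ∀ j, q j = 0)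

/-- `A` has a free filtration `∅ = A₀ ⊂ A₁ ⊂ ⋯ ⊂ A_n = A`, `|A_i| = i`, each `A_i` free. -/
def HasFreeFiltration (A : Finset (Submodule K (Fin ℓ → K))) : Prop :=
  ∃ c : ℕ → Finset (Submodule K (Fin ℓ → K)),
    c A.card = A ∧ (∀ i ≤ A.card, (c i).card = i ∧ IsFree (c i)) ∧
    ∀ i < A.card, c i ⊆ c (i + 1)

/-- The intersection lattices of `A` and `B` are isomorphic: there is a bijection of
hyperplanes preserving the rank of every subset (equivalently, a lattice isomorphism). -/
def LatticeEquiv (A B : Finset (Submodule K (Fin ℓ → K))) : Prop :=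
  ∃ σ : Submodule K (Fin ℓ → K) → Submodule K (Fin ℓ → K),
    Set.BijOn σ ↑A ↑B ∧
    ∀ T ⊆ A, Module.finrank K ((T.inf id : Submodule K (Fin ℓ → K))) =
      Module.finrank K (((T.image σ).inf id : Submodule K (Fin ℓ → K)))



lemma linPoly_add (φ ψ : Module.Dual K (Fin ℓ → K)) : linPoly (φ + ψ) = linPoly φ + linPoly ψ := by
  simp [linPoly, add_mul, Finset.sum_add_distrib]

lemma linPoly_smul (c : K) (ψ : Module.Dual K (Fin ℓ → K)) :
    linPoly (c • ψ) = C c * linPoly ψ := by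
  simp [linPoly, Finset.mul_sum, mul_assoc]

lemma applyLin_addφ (θ : Deriv K ℓ) (φ ψ : Module.Dual K (Fin ℓ → K)) :
    applyLin θ (φ + ψ) = applyLin θ φ + applyLin θ ψ := by
  simp [applyLin, add_mul, Finset.sum_add_distrib]

lemma applyLin_smulφ (c : K) (θ : Deriv K ℓ) (ψ : Module.Dual K (Fin ℓ → K)) :
    applyLin θ (c • ψ) = C c * applyLin θ ψ := by
  simp [applyLin, Finset.mul_sum, mul_assoc]

/-- `applyLin` as a linear map in the derivation. -/
def appl (φ : Module.Dual K (Fin ℓ → K)) : Deriv K ℓ →ₗ[MvPolynomial (Fin ℓ) K] MvPolynomial (Fin ℓ) K where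
  toFun θ := applyLin θ φ
  map_add' θ η := by simp [applyLin, mul_add, Finset.sum_add_distrib]
  map_smul' c θ := by
    simp only [applyLin, Pi.smul_apply, smul_eq_mul, Finset.mul_sum, RingHom.id_apply]
    exact Finset.sum_congr rfl fun i _ => by ring

lemma appl_apply (φ : Module.Dual K (Fin ℓ → K)) (θ : Deriv K ℓ) : appl φ θ = applyLin θ φ := rfl

lemma dual_apply (φ : Module.Dual K (Fin ℓ → K)) (x : Fin ℓ → K) :
    φ x = ∑ i, φ (Pi.single i 1) * x i := by
  conv_lhs => rw [pi_eq_sum_univ' x]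
  simp [map_sum, mul_comm]
  

lemma linPoly_coeff (φ : Module.Dual K (Fin ℓ → K)) (i : Fin ℓ) :
    coeff (Finsupp.single i 1) (linPoly φ) = φ (Pi.single i 1) := by
  classical
  simp [linPoly, coeff_sum, coeff_C_mul, coeff_X, Finsupp.single_left_inj]

lemma linPoly_eq_zero {φ : Module.Dual K (Fin ℓ → K)} (h : linPoly φ = 0) : φ = 0 := by
  ext i
  have := linPoly_coeff φ i
  simp [h] at this
  simpa using this.symm

lemma linPoly_homog (φ : Module.Dual K (Fin ℓ → K)) : (linPoly φ).IsHomogeneous 1 := by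
  apply IsHomogeneous.sum
  intro i _
  exact isHomogeneous_C_mul_X _ _

lemma appl_homog (φ : Module.Dual K (Fin ℓ → K)) {θ : Deriv K ℓ} {n : ℕ} (h : HomogDeriv θ n) :
    (applyLin θ φ).IsHomogeneous n := by
  apply IsHomogeneous.sum
  intro i _
  exact (h i).C_mul _

/-- Data of a restriction to the hyperplane `ker φ`. -/
structure Restr {n : ℕ} (φ : Module.Dual K (Fin (n+1) → K)) where
  ρ : MvPolynomial (Fin (n+1)) K →ₐ[K] MvPolynomial (Fin n) K
  σ : MvPolynomial (Fin n) K →ₐ[K] MvPolynomial (Fin (n+1)) K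
  W : (Fin n → K) →ₗ[K] (Fin (n+1) → K)
  v : Fin (n+1) → K
  hv : φ v = 1
  ρσ : ∀ f, ρ (σ f) = f
  ker : ∀ f, ρ f = 0 ↔ linPoly φ ∣ f
  hρ : ∀ f k, f.IsHomogeneous k → (ρ f).IsHomogeneous k
  hσ : ∀ f k, f.IsHomogeneous k → (σ f).IsHomogeneous k
  lin : ∀ ψ, ρ (linPoly ψ) = linPoly (ψ ∘ₗ W)
  rangeW : LinearMap.range W = LinearMap.ker φ

lemma exists_restr {n : ℕ} (φ : Module.Dual K (Fin (n+1) → K)) (h : φ ≠ 0) :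
    Nonempty (Restr φ) := by
  obtain ⟨v0, hv0⟩ : ∃ v, φ v ≠ 0 := by
    by_contra hc
    push Not at hc
    exact h (LinearMap.ext hc)
  set v := (φ v0)⁻¹ • v0 with hvdef
  have hv : φ v = 1 := by simp [hvdef, hv0]
  have hfin : Module.finrank K (LinearMap.ker φ) = n := by
    have := Module.Dual.finrank_ker_add_one_of_ne_zero h
    simp at this
    exact this
  let e : (Fin n → K) ≃ₗ[K] LinearMap.ker φ :=
    LinearEquiv.ofFinrankEq _ _ (by simp [hfin])
  let W : (Fin n → K) →ₗ[K] (Fin (n+1) → K) := (LinearMap.ker φ).subtype ∘ₗ e.toLinearMap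
  -- projection to the kernel
  let p0 : (Fin (n+1) → K) →ₗ[K] (Fin (n+1) → K) := LinearMap.id - φ.smulRight v
  have hp0 : ∀ x, p0 x ∈ LinearMap.ker φ := by
    intro x
    simp [p0, hv]
  let p : (Fin (n+1) → K) →ₗ[K] LinearMap.ker φ := p0.codRestrict _ hp0
  let P : (Fin (n+1) → K) →ₗ[K] (Fin n → K) := e.symm.toLinearMap ∘ₗ p
  have hWP : ∀ x, W (P x) = x - φ x • v := by
    intro x
    simp [W, P, p, p0]
  have hφW : ∀ y, φ (W y) = 0 := by
    intro y
    have := (e y).2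
    simpa [W] using this
  have hPW : ∀ y, P (W y) = y := by
    intro y
    have : p (W y) = e y := by
      apply Subtype.ext
      simp only [p, LinearMap.codRestrict_apply, p0]
      simp [hφW]
      simp [W]
    simp [P, this]
  let ρ : MvPolynomial (Fin (n+1)) K →ₐ[K] MvPolynomial (Fin n) K :=
    aeval fun i => linPoly ((LinearMap.proj i) ∘ₗ W)
  let σ : MvPolynomial (Fin n) K →ₐ[K] MvPolynomial (Fin (n+1)) K :=
    aeval fun j => linPoly ((LinearMap.proj j) ∘ₗ P)
  have hlin : ∀ ψ, ρ (linPoly ψ) = linPoly (ψ ∘ₗ W) := by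
    intro ψ
    have e1 : ψ ∘ₗ W = ∑ i, ψ (Pi.single i 1) • ((LinearMap.proj i) ∘ₗ W) := by
      ext j
      simp only [LinearMap.comp_apply, LinearMap.sum_apply, LinearMap.smul_apply, smul_eq_mul, LinearMap.proj_apply]
      rw [dual_apply]
    rw [linPoly]
    simp only [map_sum, map_mul, ρ, aeval_X, algHom_C]
    rw [e1]
    have : ∀ (s : Finset (Fin (n+1))), linPoly (∑ i ∈ s, ψ (Pi.single i 1) • ((LinearMap.proj i) ∘ₗ W)) = ∑ i ∈ s, C (ψ (Pi.single i 1)) * linPoly ((LinearMap.proj i) ∘ₗ W) := by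
      intro s
      induction s using Finset.induction_on with
      | empty => simp [linPoly]
      | insert a s ha ih => rw [Finset.sum_insert ha, Finset.sum_insert ha, linPoly_add, linPoly_smul, ih]
    rw [this]
    rfl
  have hσlin : ∀ ψ, σ (linPoly ψ) = linPoly (ψ ∘ₗ P) := by
    intro ψ
    have e1 : ψ ∘ₗ P = ∑ i, ψ (Pi.single i 1) • ((LinearMap.proj i) ∘ₗ P) := by
      apply LinearMap.ext
      intro j
      simp only [LinearMap.comp_apply, LinearMap.sum_apply, LinearMap.smul_apply, smul_eq_mul, LinearMap.proj_apply]
      rw [dual_apply]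
    rw [linPoly]
    simp only [map_sum, map_mul, σ, aeval_X, algHom_C]
    rw [e1]
    have : ∀ (s : Finset (Fin n)), linPoly (∑ i ∈ s, ψ (Pi.single i 1) • ((LinearMap.proj i) ∘ₗ P)) = ∑ i ∈ s, C (ψ (Pi.single i 1)) * linPoly ((LinearMap.proj i) ∘ₗ P) := by
      intro s
      induction s using Finset.induction_on with
      | empty => simp [linPoly]
      | insert a s ha ih => rw [Finset.sum_insert ha, Finset.sum_insert ha, linPoly_add, linPoly_smul, ih]
    rw [this]
    rfl
  have hX : ∀ (m : ℕ) (i : Fin m), linPoly (K := K) (LinearMap.proj i : Module.Dual K (Fin m → K)) = X i := by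
    intro m i
    simp [linPoly, Pi.single_apply]
  have hρσ : ∀ f, ρ (σ f) = f := by
    intro f
    have : (ρ.comp σ) = AlgHom.id K _ := by
      apply MvPolynomial.algHom_ext
      intro j
      simp only [AlgHom.comp_apply, σ, aeval_X, hlin, AlgHom.id_apply]
      rw [← hX]
      congr 1
      apply LinearMap.ext
      intro y
      simp [hPW]
    exact DFunLike.congr_fun this f
  refine ⟨⟨ρ, σ, W, v, hv, hρσ, ?_, ?_, ?_, hlin, ?_⟩⟩
  · intro f
    constructor
    · intro hf
      have key : ((Ideal.Quotient.mkₐ K (Ideal.span {linPoly φ})).comp (σ.comp ρ)) = Ideal.Quotient.mkₐ K (Ideal.span {linPoly φ}) := by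
        apply MvPolynomial.algHom_ext
        intro i
        simp only [AlgHom.comp_apply]
        rw [Ideal.Quotient.mkₐ_eq_mk, Ideal.Quotient.eq, Ideal.mem_span_singleton]
        have : σ (ρ (X i)) = X i + C (- v i) * linPoly φ := by
          rw [← hX, hlin, hσlin, ← linPoly_smul, ← linPoly_add]
          congr 1
          apply LinearMap.ext
          intro x
          simp [hWP]
          ring
        rw [this]
        exact ⟨C (- v i), by ring⟩
      have := DFunLike.congr_fun key f
      simp only [AlgHom.comp_apply, hf, map_zero] at this
      rw [Ideal.Quotient.mkₐ_eq_mk] at this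
      rw [eq_comm, Ideal.Quotient.eq_zero_iff_mem, Ideal.mem_span_singleton] at this
      exact this
    · rintro ⟨g, rfl⟩
      rw [map_mul, hlin]
      have : φ ∘ₗ W = 0 := LinearMap.ext hφW
      rw [this]
      simp [linPoly]
  · intro f k hf
    have := hf.aeval (τ := Fin n) (fun i => linPoly ((LinearMap.proj i) ∘ₗ W)) (n := 1) (fun i => linPoly_homog _)
    rwa [one_mul] at this
  · intro f k hf
    have := hf.aeval (τ := Fin (n+1)) (fun i => linPoly ((LinearMap.proj i) ∘ₗ P)) (n := 1) (fun i => linPoly_homog _)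
    rwa [one_mul] at this
  · simp only [W]
    rw [LinearMap.range_comp]
    simp

lemma linPoly_prime {n : ℕ} {φ : Module.Dual K (Fin (n+1) → K)} (h : φ ≠ 0) : Prime (linPoly φ) := by
  obtain ⟨R⟩ := exists_restr φ h
  refine ⟨fun h0 => h (linPoly_eq_zero h0), ?_, ?_⟩
  · intro hu
    have h1 : linPoly φ ∣ 1 := hu.dvd
    rw [← R.ker] at h1
    simp at h1
  · intro a b hab
    rw [← R.ker, map_mul, mul_eq_zero] at hab
    rwa [R.ker, R.ker] at hab

lemma dvd_ker {n : ℕ} {φ ψ : Module.Dual K (Fin (n+1) → K)} (h : φ ≠ 0)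
    (hd : linPoly φ ∣ linPoly ψ) : LinearMap.ker φ ≤ LinearMap.ker ψ := by
  obtain ⟨R⟩ := exists_restr φ h
  rw [← R.ker, R.lin] at hd
  have := linPoly_eq_zero hd
  rw [← R.rangeW]
  rintro _ ⟨y, rfl⟩
  exact DFunLike.congr_fun this y

lemma ker_le_smul {φ ψ : Module.Dual K (Fin ℓ → K)}
    (hk : LinearMap.ker φ ≤ LinearMap.ker ψ) : ∃ c : K, ψ = c • φ := by
  have := mem_span_of_iInf_ker_le_ker (ι := Unit) (L := fun _ => φ) (K := ψ) (by simpa using hk)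
  simp [Submodule.mem_span_singleton] at this
  obtain ⟨c, hc⟩ := this
  exact ⟨c, hc.symm⟩

lemma ker_le_eq {φ ψ : Module.Dual K (Fin ℓ → K)} (hψ : ψ ≠ 0)
    (hk : LinearMap.ker φ ≤ LinearMap.ker ψ) : LinearMap.ker φ = LinearMap.ker ψ := by
  obtain ⟨c, rfl⟩ := ker_le_smul hk
  have hc : c ≠ 0 := by
    rintro rfl
    simp at hψ
  rw [LinearMap.ker_smul _ _ hc]

lemma linPoly_dvd_of_ker {φ ψ : Module.Dual K (Fin ℓ → K)}
    (hk : LinearMap.ker φ ≤ LinearMap.ker ψ) : linPoly φ ∣ linPoly ψ := by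
  obtain ⟨c, rfl⟩ := ker_le_smul hk
  rw [linPoly_smul]
  exact Dvd.intro_left _ rfl

lemma linPoly_relPrime {n : ℕ} {φ ψ : Module.Dual K (Fin (n+1) → K)} (h : φ ≠ 0) (hψ : ψ ≠ 0)
    (hne : LinearMap.ker φ ≠ LinearMap.ker ψ) : IsRelPrime (linPoly φ) (linPoly ψ) := by
  rw [(linPoly_prime h).irreducible.isRelPrime_iff_not_dvd]
  intro hd
  exact hne (ker_le_eq hψ (dvd_ker h hd))

/-- A third form vanishing on the intersection of two. -/
lemma two_span {φ ψ χ : Module.Dual K (Fin ℓ → K)}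
    (hk : LinearMap.ker φ ⊓ LinearMap.ker ψ ≤ LinearMap.ker χ) :
    ∃ s t : K, χ = s • φ + t • ψ := by
  have := mem_span_of_iInf_ker_le_ker (ι := Bool) (L := fun b => if b then φ else ψ) (K := χ) (by
    intro x hx
    simp at hx
    exact hk ⟨hx.2, hx.1⟩)
  have h2 : Set.range (fun b : Bool => if b then φ else ψ) = {φ, ψ} := by
    ext; simp [eq_comm, or_comm]
  rw [h2, Submodule.mem_span_pair] at this
  obtain ⟨s, t, h⟩ := this
  exact ⟨s, t, h.symm⟩



section graded
attribute [local instance] MvPolynomial.gradedAlgebra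

lemma hdec {σ : Type} (f : MvPolynomial σ K) (i : ℕ) :
    ((DirectSum.decompose (homogeneousSubmodule σ K) f) i : MvPolynomial σ K) = homogeneousComponent i f :=
  decomposition.decompose'_apply f i

lemma hc_mul {σ : Type} {f g : MvPolynomial σ K} {e : ℕ} (hg : g.IsHomogeneous e) (n : ℕ) :
    homogeneousComponent (n + e) (f * g) = homogeneousComponent n f * g := by
  have := DirectSum.coe_decompose_mul_of_right_mem_of_le (homogeneousSubmodule σ K) (a := f) (b := g)
    (i := e) (n := n + e) ((mem_homogeneousSubmodule _ _).2 hg) (by omega)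
  rw [hdec, hdec] at this
  simpa using this

lemma hc_mul_lt {σ : Type} {f g : MvPolynomial σ K} {e : ℕ} (hg : g.IsHomogeneous e) {n : ℕ}
    (h : n < e) : homogeneousComponent n (f * g) = 0 := by
  have := DirectSum.coe_decompose_mul_of_right_mem_of_not_le (homogeneousSubmodule σ K) (a := f) (b := g)
    (i := e) (n := n) ((mem_homogeneousSubmodule _ _).2 hg) (by omega)
  rwa [hdec] at this

end graded

lemma hc_self {σ : Type} {f : MvPolynomial σ K} {n : ℕ} (h : f.IsHomogeneous n) :
    homogeneousComponent n f = f := homogeneousComponent_eq_self h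

lemma hc_map {σ τ : Type} (ρ : MvPolynomial σ K →ₐ[K] MvPolynomial τ K)
    (hρ : ∀ f k, f.IsHomogeneous k → (ρ f).IsHomogeneous k) (n : ℕ) (f : MvPolynomial σ K) :
    homogeneousComponent n (ρ f) = ρ (homogeneousComponent n f) := by
  conv_lhs => rw [← sum_homogeneousComponent f]
  rw [map_sum, map_sum]
  have : ∀ i ∈ Finset.range (f.totalDegree + 1),
      homogeneousComponent n (ρ (homogeneousComponent i f)) = if n = i then ρ (homogeneousComponent n f) else 0 := by
    intro i _
    rw [homogeneousComponent_of_mem ((mem_homogeneousSubmodule i _).2 (hρ _ _ (homogeneousComponent_isHomogeneous i f)))]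
    by_cases h : n = i
    · subst h; simp
    · simp [h]
  rw [Finset.sum_congr rfl this, Finset.sum_ite_eq]
  split_ifs with h
  · rfl
  · rw [homogeneousComponent_eq_zero, map_zero]
    simp at h; omega

/-- homogeneous component of a derivation. -/
def hcD (n : ℕ) (θ : Deriv K ℓ) : Deriv K ℓ := fun i => homogeneousComponent n (θ i)

lemma hcD_homog (n : ℕ) (θ : Deriv K ℓ) : HomogDeriv (hcD n θ) n :=
  fun _ => homogeneousComponent_isHomogeneous _ _

lemma hcD_apply (n : ℕ) (θ : Deriv K ℓ) (φ : Module.Dual K (Fin ℓ → K)) :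
    applyLin (hcD n θ) φ = homogeneousComponent n (applyLin θ φ) := by
  simp [applyLin, hcD, map_sum, homogeneousComponent_C_mul]

lemma hcD_self {n : ℕ} {θ : Deriv K ℓ} (h : HomogDeriv θ n) : hcD n θ = θ :=
  funext fun i => hc_self (h i)

lemma hcD_add (n : ℕ) (θ η : Deriv K ℓ) : hcD n (θ + η) = hcD n θ + hcD n η :=
  funext fun i => by simp [hcD]

lemma hcD_sum {ι : Type} (s : Finset ι) (n : ℕ) (θ : ι → Deriv K ℓ) :
    hcD n (∑ i ∈ s, θ i) = ∑ i ∈ s, hcD n (θ i) :=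
  funext fun i => by simp [hcD, Finset.sum_apply]

/-- the coefficient in degree `n` of multiplication by something of degree `e`. -/
def hcs (n e : ℕ) (f : MvPolynomial (Fin ℓ) K) : MvPolynomial (Fin ℓ) K :=
  if e ≤ n then homogeneousComponent (n - e) f else 0

lemma hcs_homog (n e : ℕ) (f : MvPolynomial (Fin ℓ) K) : (hcs n e f).IsHomogeneous (n - e) := by
  unfold hcs
  split_ifs
  · exact homogeneousComponent_isHomogeneous _ _
  · exact isHomogeneous_zero _ _ _

lemma hcs_mul {f g : MvPolynomial (Fin ℓ) K} {e : ℕ} (hg : g.IsHomogeneous e) (n : ℕ) :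
    homogeneousComponent n (f * g) = hcs n e f * g := by
  unfold hcs
  split_ifs with h
  · rw [← hc_mul hg]; congr; omega
  · rw [hc_mul_lt hg (by omega), zero_mul]

lemma hcD_smul {f : MvPolynomial (Fin ℓ) K} {θ : Deriv K ℓ} {e : ℕ} (hg : HomogDeriv θ e) (n : ℕ) :
    hcD n (f • θ) = hcs n e f • θ :=
  funext fun i => by simp [hcD, hcs_mul (hg i)]

/-- `D(A)` as a submodule. -/
def DM (A : Finset (Submodule K (Fin ℓ → K))) : Submodule (MvPolynomial (Fin ℓ) K) (Deriv K ℓ) where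
  carrier := {θ | InD A θ}
  add_mem' := by
    intro a b ha hb H hH φ hφ
    rw [← appl_apply, map_add]
    exact dvd_add (ha H hH φ hφ) (hb H hH φ hφ)
  zero_mem' := by
    intro H hH φ hφ
    rw [← appl_apply, map_zero]
    exact dvd_zero _
  smul_mem' := by
    intro c x hx H hH φ hφ
    rw [← appl_apply, map_smul]
    exact Dvd.dvd.mul_left (hx H hH φ hφ) c

lemma mem_DM {A : Finset (Submodule K (Fin ℓ → K))} {θ : Deriv K ℓ} : θ ∈ DM A ↔ InD A θ := Iff.rfl

lemma hcD_mem {A : Finset (Submodule K (Fin ℓ → K))} {θ : Deriv K ℓ} (h : θ ∈ DM A) (n : ℕ) :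
    hcD n θ ∈ DM A := by
  intro H hH φ hφ
  rw [hcD_apply]
  obtain ⟨g, hg⟩ := h H hH φ hφ
  rw [hg, mul_comm, hcs_mul (linPoly_homog φ)]
  exact Dvd.intro_left _ rfl

/-- if `p θ` and `q θ` are in `D(A)` with `p, q` coprime then `θ ∈ D(A)`. -/
lemma mem_of_relPrime {n : ℕ} {A : Finset (Submodule K (Fin (n+1) → K))} (hA : IsArrangement A)
    {p q : MvPolynomial (Fin (n+1)) K} (hpq : IsRelPrime p q) {θ : Deriv K (n+1)}
    (h1 : p • θ ∈ DM A) (h2 : q • θ ∈ DM A) : θ ∈ DM A := by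
  intro H hH φ hφ
  have hφ0 : φ ≠ 0 := by
    rintro rfl
    obtain ⟨ψ, hψ, hk⟩ := hA H hH
    rw [← hφ, LinearMap.ker_zero, LinearMap.ker_eq_top] at hk
    exact hψ hk
  have hp := linPoly_prime hφ0
  have e1 := h1 H hH φ hφ
  have e2 := h2 H hH φ hφ
  rw [← appl_apply, map_smul, smul_eq_mul] at e1 e2
  rcases hp.dvd_or_dvd e1 with e1 | e1
  · rcases hp.dvd_or_dvd e2 with e2 | e2
    · exact absurd (hpq e1 e2) hp.not_isUnit
    · exact e2
  · exact e1

lemma arr_ne_zero {A : Finset (Submodule K (Fin ℓ → K))} (hA : IsArrangement A)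
    {H : Submodule K (Fin ℓ → K)} (hH : H ∈ A) {φ : Module.Dual K (Fin ℓ → K)}
    (hφ : LinearMap.ker φ = H) : φ ≠ 0 := by
  rintro rfl
  obtain ⟨ψ, hψ, hk⟩ := hA H hH
  rw [← hφ, LinearMap.ker_zero, LinearMap.ker_eq_top] at hk
  exact hψ hk

/-- membership tested with one form for each hyperplane -/
lemma inD_insert {A : Finset (Submodule K (Fin ℓ → K))} {H : Submodule K (Fin ℓ → K)}
    {φ : Module.Dual K (Fin ℓ → K)} (hφ : LinearMap.ker φ = H) {θ : Deriv K ℓ} :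
    θ ∈ DM (insert H A) ↔ θ ∈ DM A ∧ linPoly φ ∣ applyLin θ φ := by
  constructor
  · intro h
    exact ⟨fun L hL => h L (Finset.mem_insert_of_mem hL), h H (Finset.mem_insert_self _ _) φ hφ⟩
  · rintro ⟨h1, h2⟩ L hL ψ hψ
    rcases Finset.mem_insert.1 hL with rfl | hL
    · obtain ⟨c, rfl⟩ := ker_le_smul (φ := φ) (ψ := ψ) (by rw [hφ, hψ])
      rw [applyLin_smulφ]
      exact (linPoly_dvd_of_ker (by rw [hφ, hψ])).trans (h2.mul_left _)
    · exact h1 L hL ψ hψ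



lemma homog_one {f : MvPolynomial (Fin 1) K} {k : ℕ} (h : f.IsHomogeneous k) :
    ∃ c : K, f = C c * X 0 ^ k := by
  refine ⟨coeff (Finsupp.single 0 k) f, ?_⟩
  ext m
  rw [coeff_C_mul, coeff_X_pow]
  by_cases hm : Finsupp.single 0 k = m
  · simp [hm]
  · simp only [hm, if_false, mul_zero]
    apply h.coeff_eq_zero
    intro hk
    apply hm
    refine Finsupp.ext fun i => ?_
    fin_cases i
    simp [Finsupp.degree_eq_sum] at hk
    simp [hk]

lemma bez {ψ : Module.Dual K (Fin 2 → K)} (hψ : ψ ≠ 0) {P g : MvPolynomial (Fin 2) K} {k m : ℕ}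
    (hP : P.IsHomogeneous k) (hnd : ¬ linPoly ψ ∣ P) (hg : g.IsHomogeneous m) (hkm : k ≤ m) :
    ∃ u w, w.IsHomogeneous (m - 1) ∧ g = u * P + w * linPoly ψ := by
  obtain ⟨R⟩ := exists_restr ψ hψ
  obtain ⟨c, hc⟩ := homog_one (R.hρ _ _ hP)
  obtain ⟨c', hc'⟩ := homog_one (R.hρ _ _ hg)
  have hc0 : c ≠ 0 := by
    rintro rfl
    apply hnd
    rw [← R.ker, hc]
    simp
  set u := R.σ (C (c' / c) * X 0 ^ (m - k)) with hu
  have huh : u.IsHomogeneous (m - k) := R.hσ _ _ (isHomogeneous_C_mul_X_pow _ _ _)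
  have hd : linPoly ψ ∣ g - u * P := by
    rw [← R.ker, map_sub, map_mul, hu, R.ρσ, hc, hc']
    have : (X 0 : MvPolynomial (Fin 1) K) ^ m = X 0 ^ (m - k) * X 0 ^ k := by
      rw [← pow_add]; congr; omega
    rw [this]
    have : (C c' : MvPolynomial (Fin 1) K) = C (c' / c) * C c := by
      rw [← C_mul, div_mul_cancel₀ _ hc0]
    rw [this]; ring
  obtain ⟨w, hw⟩ := hd
  refine ⟨u, hcs m 1 w, hcs_homog _ _ _, ?_⟩
  rw [← hcs_mul (linPoly_homog ψ), mul_comm w, ← hw, hc_self]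
  · ring
  · have := huh.mul hP
    rw [Nat.sub_add_cancel hkm] at this
    exact hg.sub this

lemma partfrac {ι : Type} [DecidableEq ι] (ψ : ι → Module.Dual K (Fin 2 → K)) (s : Finset ι) (hs : s.Nonempty)
    (h0 : ∀ i ∈ s, ψ i ≠ 0)
    (hne : ∀ i ∈ s, ∀ j ∈ s, i ≠ j → LinearMap.ker (ψ i) ≠ LinearMap.ker (ψ j)) :
    ∀ (m : ℕ) (g : MvPolynomial (Fin 2) K), g.IsHomogeneous m → s.card ≤ m + 1 →
    ∃ c : ι → MvPolynomial (Fin 2) K, g = ∑ i ∈ s, c i * ∏ j ∈ s.erase i, linPoly (ψ j) := by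
  induction hs using Finset.Nonempty.cons_induction with
  | singleton a =>
    intro m g hg _
    exact ⟨fun _ => g, by simp⟩
  | cons a s ha hs ih =>
    intro m g hg hm
    have hP : (∏ j ∈ s, linPoly (ψ j)).IsHomogeneous s.card := by
      have := IsHomogeneous.prod s (fun j => linPoly (ψ j)) (fun _ => 1) (fun j _ => linPoly_homog _)
      simpa using this
    have ha0 := h0 a (by simp)
    have hnd : ¬ linPoly (ψ a) ∣ ∏ j ∈ s, linPoly (ψ j) := by
      intro hd
      rw [(linPoly_prime ha0).dvd_finsetProd_iff] at hd
      obtain ⟨j, hj, hd⟩ := hd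
      exact hne a (by simp) j (by simp [hj]) (by rintro rfl; exact ha hj)
        (ker_le_eq (h0 j (by simp [hj])) (dvd_ker ha0 hd))
    rw [Finset.card_cons] at hm
    obtain ⟨u, w, hw, hgu⟩ := bez ha0 hP hnd hg (by omega)
    have hs1 := hs.card_pos
    obtain ⟨c, hc⟩ := ih (fun i hi => h0 i (by simp [hi]))
      (fun i hi j hj => hne i (by simp [hi]) j (by simp [hj])) (m - 1) w hw (by omega)
    refine ⟨fun i => if i = a then u else c i, ?_⟩
    rw [Finset.cons_eq_insert, Finset.sum_insert ha, Finset.erase_insert ha, hgu]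
    simp only [if_true]
    congr 1
    conv_lhs => rw [hc]
    rw [Finset.sum_mul]
    apply Finset.sum_congr rfl
    intro i hi
    have hia : i ≠ a := by rintro rfl; exact ha hi
    rw [if_neg hia, Finset.erase_insert_of_ne (Ne.symm hia), Finset.prod_insert (by simp [ha])]
    ring

lemma exists_reps {α β : Type} [Nonempty α] [DecidableEq α] [DecidableEq β] (s : Finset α) (f : α → β) :
    ∃ r ⊆ s, Set.InjOn f r ∧ r.image f = s.image f := by
  have : ∀ b ∈ s.image f, ∃ a ∈ s, f a = b := by simp
  choose! g hg using this
  refine ⟨(s.image f).image g, ?_, ?_, ?_⟩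
  · intro x hx
    obtain ⟨b, hb, rfl⟩ := Finset.mem_image.1 hx
    exact (hg b hb).1
  · intro x hx y hy hxy
    obtain ⟨b, hb, rfl⟩ := Finset.mem_image.1 hx
    obtain ⟨b', hb', rfl⟩ := Finset.mem_image.1 hy
    rw [(hg b hb).2, (hg b' hb').2] at hxy
    rw [hxy]
  · ext b
    simp only [Finset.mem_image]
    constructor
    · rintro ⟨_, ⟨c, ⟨a, ha, rfl⟩, rfl⟩, rfl⟩
      exact ⟨g (f a), (hg (f a) (Finset.mem_image_of_mem _ ha)).1, rfl⟩
    · rintro ⟨a, ha, rfl⟩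
      exact ⟨g (f a), ⟨f a, ⟨a, ha, rfl⟩, rfl⟩, (hg (f a) (Finset.mem_image_of_mem _ ha)).2⟩

/-- The key polynomial `B`. -/
lemma key {A : Finset (Submodule K (Fin 3 → K))} (hA : IsArrangement A)
    {φ : Module.Dual K (Fin 3 → K)} (hφ : φ ≠ 0) (hn : LinearMap.ker φ ∉ A) (R : Restr φ) :
    ∃ (B : MvPolynomial (Fin 2) K) (d : ℕ), B ≠ 0 ∧ B.IsHomogeneous d ∧
      d + (A.image (fun L => L ⊓ LinearMap.ker φ)).card = A.card ∧
      (∀ θ ∈ DM A, B ∣ R.ρ (applyLin θ φ)) ∧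
      (∀ (m : ℕ) (g : MvPolynomial (Fin 2) K), A.card ≤ m + 1 → g.IsHomogeneous m →
        ∃ θ ∈ DM A, HomogDeriv θ (m + d) ∧ R.ρ (applyLin θ φ) = B * g) := by
  choose! ψ hψ0 hψ using hA
  have hA : IsArrangement A := fun H hH => ⟨ψ H, hψ0 H hH, hψ H hH⟩
  obtain ⟨r, hrA, hinj, him⟩ := exists_reps A (fun L => L ⊓ LinearMap.ker φ)
  set χ : Submodule K (Fin 3 → K) → Module.Dual K (Fin 2 → K) := fun L => ψ L ∘ₗ R.W with hχ
  have hχ0 : ∀ L ∈ A, χ L ≠ 0 := by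
    intro L hL h0
    have : LinearMap.ker φ ≤ LinearMap.ker (ψ L) := by
      rw [← R.rangeW]
      rintro _ ⟨y, rfl⟩
      exact DFunLike.congr_fun h0 y
    have := ker_le_eq (hψ0 L hL) this
    rw [hψ L hL] at this
    exact hn (this ▸ hL)
  have hχne : ∀ L ∈ A, ∀ M ∈ A, L ⊓ LinearMap.ker φ ≠ M ⊓ LinearMap.ker φ →
      LinearMap.ker (χ L) ≠ LinearMap.ker (χ M) := by
    intro L hL M hM hne he
    apply hne
    have : ∀ x ∈ LinearMap.ker φ, x ∈ L ↔ x ∈ M := by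
      intro x hx
      rw [← R.rangeW] at hx
      obtain ⟨y, rfl⟩ := hx
      have : y ∈ LinearMap.ker (χ L) ↔ y ∈ LinearMap.ker (χ M) := by rw [he]
      rw [← hψ L hL, ← hψ M hM]
      simpa [hχ] using this
    ext x
    simp only [Submodule.mem_inf]
    constructor
    · rintro ⟨h1, h2⟩; exact ⟨(this x h2).1 h1, h2⟩
    · rintro ⟨h1, h2⟩; exact ⟨(this x h2).2 h1, h2⟩
  have hrne : ∀ i ∈ r, ∀ j ∈ r, i ≠ j → LinearMap.ker (χ i) ≠ LinearMap.ker (χ j) := by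
    intro i hi j hj hij
    exact hχne i (hrA hi) j (hrA hj) fun h => hij (hinj hi hj h)
  refine ⟨∏ L ∈ A \ r, linPoly (χ L), (A \ r).card, ?_, ?_, ?_, ?_, ?_⟩
  · rw [Finset.prod_ne_zero_iff]
    intro L hL h0
    exact hχ0 L (Finset.mem_sdiff.1 hL).1 (linPoly_eq_zero h0)
  · have := IsHomogeneous.prod (A \ r) (fun j => linPoly (χ j)) (fun _ => 1) (fun j _ => linPoly_homog _)
    simpa using this
  · rw [← him, Finset.card_image_of_injOn hinj, Finset.card_sdiff_add_card_eq_card hrA]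
  · intro θ hθ
    rw [← Finset.prod_fiberwise_of_maps_to (t := A.image (fun L => L ⊓ LinearMap.ker φ))
      (g := fun L => L ⊓ LinearMap.ker φ)
      (fun L hL => Finset.mem_image_of_mem _ (Finset.mem_sdiff.1 hL).1)]
    apply Finset.prod_dvd_of_isRelPrime
    · intro X _ Y _ hXY
      apply IsRelPrime.prod_left
      intro L hL
      apply IsRelPrime.prod_right
      intro M hM
      simp only [Finset.mem_filter, Finset.mem_sdiff] at hL hM
      apply linPoly_relPrime (hχ0 L hL.1.1) (hχ0 M hM.1.1)
      apply hχne L hL.1.1 M hM.1.1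
      rw [hL.2, hM.2]
      exact hXY
    · intro X hX
      rw [← him] at hX
      obtain ⟨L, hL, rfl⟩ := Finset.mem_image.1 hX
      have hLA := hrA hL
      obtain ⟨h, hh⟩ := hθ L hLA (ψ L) (hψ L hLA)
      have hdv : ∏ M ∈ (A \ r).filter (fun M => M ⊓ LinearMap.ker φ = L ⊓ LinearMap.ker φ), linPoly (ψ M)
          ∣ applyLin θ φ - h * linPoly φ := by
        apply Finset.prod_dvd_of_isRelPrime
        · intro M hM N hN hMN
          simp only [Finset.coe_filter, Finset.mem_sdiff, Set.mem_ofPred_eq] at hM hN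
          apply linPoly_relPrime (hψ0 M hM.1.1) (hψ0 N hN.1.1)
          rw [hψ M hM.1.1, hψ N hN.1.1]
          exact hMN
        · intro M hM
          simp only [Finset.mem_filter, Finset.mem_sdiff] at hM
          have hMA := hM.1.1
          obtain ⟨s, t, hst⟩ := two_span (φ := ψ L) (ψ := φ) (χ := ψ M) (by
            rw [hψ L hLA, ← hM.2, hψ M hMA]; exact inf_le_left)
          have ht : t ≠ 0 := by
            rintro rfl
            rw [zero_smul, add_zero] at hst
            have : LinearMap.ker (ψ L) = LinearMap.ker (ψ M) := by
              apply ker_le_eq (hψ0 M hMA)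
              rw [hst]
              exact LinearMap.ker_le_ker_smul _ _
            rw [hψ L hLA, hψ M hMA] at this
            exact hM.1.2 (this ▸ hL)
          have h1 := hθ M hMA (ψ M) (hψ M hMA)
          have e1 : applyLin θ (ψ M) = C s * applyLin θ (ψ L) + C t * applyLin θ φ := by
            rw [hst, applyLin_addφ, applyLin_smulφ, applyLin_smulφ]
          have e2 : linPoly (ψ M) = C s * linPoly (ψ L) + C t * linPoly φ := by
            rw [hst, linPoly_add, linPoly_smul, linPoly_smul]
          have h2 : linPoly (ψ M) ∣ C t * (applyLin θ φ - h * linPoly φ) := by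
            have : C t * (applyLin θ φ - h * linPoly φ) = applyLin θ (ψ M) - h * linPoly (ψ M) := by
              rw [e1, hh, e2]; ring
            rw [this]
            exact dvd_sub h1 (Dvd.intro_left _ rfl)
          have hu : IsUnit (C t : MvPolynomial (Fin 3) K) := (isUnit_iff_ne_zero.2 ht).map C
          exact hu.dvd_mul_left.1 h2
      have := map_dvd R.ρ hdv
      rw [map_prod, map_sub, map_mul, (R.ker (linPoly φ)).2 dvd_rfl, mul_zero, sub_zero] at this
      simpa only [R.lin] using this
  · intro m g hm hg
    -- it suffices to find a not necessarily homogeneous one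
    have hBh : (∏ L ∈ A \ r, linPoly (χ L)).IsHomogeneous (A \ r).card := by
      have := IsHomogeneous.prod (A \ r) (fun j => linPoly (χ j)) (fun _ => 1) (fun j _ => linPoly_homog _)
      simpa using this
    suffices hs : ∃ θ ∈ DM A, R.ρ (applyLin θ φ) = (∏ L ∈ A \ r, linPoly (χ L)) * g by
      obtain ⟨θ, hθ, he⟩ := hs
      refine ⟨hcD (m + (A \ r).card) θ, hcD_mem hθ _, hcD_homog _ _, ?_⟩
      rw [hcD_apply, ← hc_map R.ρ R.hρ, he, hc_self]
      rw [add_comm]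
      exact hBh.mul hg
    rcases A.eq_empty_or_nonempty with rfl | hne
    · refine ⟨R.σ g • fun i => C (R.v i), ?_, ?_⟩
      · intro H hH; simp at hH
      · rw [← appl_apply, map_smul, appl_apply]
        have : applyLin (fun i => C (R.v i)) φ = 1 := by
          rw [applyLin]
          simp only [← C_mul, ← map_sum]
          rw [← dual_apply, R.hv, C_1]
        rw [this]
        simp [R.ρσ]
    · have hrn : r.Nonempty := by
        rw [← Finset.image_nonempty (f := (fun L => L ⊓ LinearMap.ker φ)), him]
        simpa using hne
      obtain ⟨c, hc⟩ := partfrac χ r hrn (fun i hi => hχ0 i (hrA hi)) hrne m g hg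
        ((Finset.card_le_card hrA).trans hm)
      have hv : ∀ L ∈ A, ∃ v : Fin 3 → K, ψ L v = 0 ∧ φ v = 1 := by
        intro L hL
        have : ¬ LinearMap.ker (ψ L) ≤ LinearMap.ker φ := by
          intro h
          have := ker_le_eq hφ h
          rw [hψ L hL] at this
          exact hn (this ▸ hL)
        rw [SetLike.not_le_iff_exists] at this
        obtain ⟨v, h1, h2⟩ := this
        have h2 : φ v ≠ 0 := h2
        refine ⟨(φ v)⁻¹ • v, ?_, ?_⟩
        · rw [map_smul, LinearMap.mem_ker.1 h1, smul_zero]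
        · simp [h2]
      choose! v hv0 hv1 using hv
      have happ : ∀ (v : Fin 3 → K) (ξ : Module.Dual K (Fin 3 → K)), applyLin (fun i => C (v i)) ξ = C (ξ v) := by
        intro v ξ
        rw [applyLin]
        simp only [← C_mul, ← map_sum]
        rw [← dual_apply]
      refine ⟨∑ L ∈ r, (R.σ (c L) * ∏ M ∈ A.erase L, linPoly (ψ M)) • (fun i => C (v L i)), ?_, ?_⟩
      · apply Submodule.sum_mem
        intro L hL N hN ξ hξ
        rw [← appl_apply, map_smul, appl_apply, happ, smul_eq_mul]
        by_cases hNL : N = L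
        · subst hNL
          obtain ⟨c, rfl⟩ := ker_le_smul (φ := ψ N) (ψ := ξ) (by rw [hξ, hψ N hN])
          simp [hv0 N hN]
        · apply Dvd.dvd.mul_right
          apply Dvd.dvd.mul_left
          have : linPoly ξ ∣ linPoly (ψ N) := linPoly_dvd_of_ker (by rw [hξ, hψ N hN])
          exact this.trans (Finset.dvd_prod_of_mem (fun M => linPoly (ψ M)) (Finset.mem_erase.2 ⟨hNL, hN⟩))
      · rw [← appl_apply, map_sum, map_sum, hc, Finset.mul_sum]
        apply Finset.sum_congr rfl
        intro L hL
        have hLA := hrA hL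
        rw [map_smul, appl_apply, happ, hv1 L hLA, smul_eq_mul, C_1, mul_one, map_mul, R.ρσ, map_prod]
        simp only [R.lin]
        have : A.erase L = (A \ r) ∪ r.erase L := by
          ext M
          simp only [Finset.mem_erase, Finset.mem_union, Finset.mem_sdiff]
          constructor
          · rintro ⟨h1, h2⟩
            by_cases hM : M ∈ r
            · exact Or.inr ⟨h1, hM⟩
            · exact Or.inl ⟨h2, hM⟩
          · rintro (⟨h1, h2⟩ | ⟨h1, h2⟩)
            · exact ⟨by rintro rfl; exact h2 hL, h1⟩
            · exact ⟨h1, hrA h2⟩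
        rw [this, Finset.prod_union]
        · simp only [hχ]
          ring
        · rw [Finset.disjoint_left]
          intro M h1 h2
          exact (Finset.mem_sdiff.1 h1).2 (Finset.mem_erase.1 h2).2



lemma X_pow_relPrime (m : ℕ) : IsRelPrime ((X 0 : MvPolynomial (Fin 2) K) ^ m) (X 1 ^ m) := by
  apply IsRelPrime.pow
  rw [(MvPolynomial.X_prime (R := K) (i := (0 : Fin 2))).irreducible.isRelPrime_iff_not_dvd, MvPolynomial.X_dvd_X]
  simp

lemma test_mem {A : Finset (Submodule K (Fin 3 → K))} {φ : Module.Dual K (Fin 3 → K)} (R : Restr φ)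
    {η : Deriv K 3} : η ∈ DM (insert (LinearMap.ker φ) A) ↔ η ∈ DM A ∧ R.ρ (applyLin η φ) = 0 := by
  rw [inD_insert rfl, R.ker]

lemma alpha_smul_mem {A : Finset (Submodule K (Fin 3 → K))} {φ : Module.Dual K (Fin 3 → K)}
    {η : Deriv K 3} (h : η ∈ DM A) : linPoly φ • η ∈ DM (insert (LinearMap.ker φ) A) := by
  rw [inD_insert rfl]
  refine ⟨Submodule.smul_mem _ _ h, ?_⟩
  rw [← appl_apply, map_smul]
  exact Dvd.intro _ rfl

lemma mem_of_alpha {A : Finset (Submodule K (Fin 3 → K))} (hA : IsArrangement A)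
    {φ : Module.Dual K (Fin 3 → K)} (hφ : φ ≠ 0) (hn : LinearMap.ker φ ∉ A)
    {η : Deriv K 3} (h : linPoly φ • η ∈ DM A) : η ∈ DM A := by
  intro H hH ψ hψ
  have hψ0 := arr_ne_zero hA hH hψ
  have := h H hH ψ hψ
  rw [← appl_apply, map_smul, smul_eq_mul] at this
  rcases (linPoly_prime hψ0).dvd_or_dvd this with h1 | h1
  · exfalso
    have := ker_le_eq hφ (dvd_ker hψ0 h1)
    rw [hψ] at this
    exact hn (this ▸ hH)
  · exact h1

lemma rho_smul {φ : Module.Dual K (Fin 3 → K)} (R : Restr φ) (c : MvPolynomial (Fin 3) K) (η : Deriv K 3) :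
    R.ρ (applyLin (c • η) φ) = R.ρ c * R.ρ (applyLin η φ) := by
  rw [← appl_apply, map_smul, smul_eq_mul, map_mul]; rfl

lemma rho_add {φ : Module.Dual K (Fin 3 → K)} (R : Restr φ) (θ η : Deriv K 3) :
    R.ρ (applyLin (θ + η) φ) = R.ρ (applyLin θ φ) + R.ρ (applyLin η φ) := by
  rw [← appl_apply, map_add, map_add]; rfl

lemma rho_sub {φ : Module.Dual K (Fin 3 → K)} (R : Restr φ) (θ η : Deriv K 3) :
    R.ρ (applyLin (θ - η) φ) = R.ρ (applyLin θ φ) - R.ρ (applyLin η φ) := by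
  rw [← appl_apply, map_sub, map_sub]; rfl

lemma rho_sum {φ : Module.Dual K (Fin 3 → K)} (R : Restr φ) {ι : Type} (s : Finset ι) (θ : ι → Deriv K 3) :
    R.ρ (applyLin (∑ i ∈ s, θ i) φ) = ∑ i ∈ s, R.ρ (applyLin (θ i) φ) := by
  rw [← appl_apply, map_sum, map_sum]; rfl

lemma smul_cancel {a : MvPolynomial (Fin 3) K} (ha : a ≠ 0) {θ η : Deriv K 3} (h : a • θ = a • η) : θ = η := by
  funext i
  have := congrFun h i
  simp only [Pi.smul_apply, smul_eq_mul] at this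
  exact mul_left_cancel₀ ha this

/-- existence of the new generator in the free case. -/
lemma exists_gen {A : Finset (Submodule K (Fin 3 → K))} (hA : IsArrangement A)
    {φ : Module.Dual K (Fin 3 → K)} (hφ : φ ≠ 0) (hn : LinearMap.ker φ ∉ A) (R : Restr φ)
    {B : MvPolynomial (Fin 2) K} {d : ℕ} (hBd : B.IsHomogeneous d)
    (hsurj : ∀ (m : ℕ) (g : MvPolynomial (Fin 2) K), A.card ≤ m + 1 → g.IsHomogeneous m →
        ∃ θ ∈ DM A, HomogDeriv θ (m + d) ∧ R.ρ (applyLin θ φ) = B * g)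
    (θ : Fin 3 → Deriv K 3) (hgen : GeneratesD (insert (LinearMap.ker φ) A) θ) (hind : IndepD θ) :
    ∃ Φ ∈ DM A, HomogDeriv Φ d ∧ R.ρ (applyLin Φ φ) = B := by
  set α := linPoly φ with hα
  have hα0 : α ≠ 0 := fun h => hφ (linPoly_eq_zero h)
  have hρα : R.ρ α = 0 := (R.ker _).2 dvd_rfl
  set g1 : MvPolynomial (Fin 2) K := X 0 ^ A.card with hg1
  set g2 : MvPolynomial (Fin 2) K := X 1 ^ A.card with hg2
  have hg10 : g1 ≠ 0 := pow_ne_zero _ (X_ne_zero _)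
  obtain ⟨ψ1, hψ1, -, he1⟩ := hsurj A.card g1 (by omega) (isHomogeneous_X_pow _ _)
  obtain ⟨ψ2, hψ2, -, he2⟩ := hsurj A.card g2 (by omega) (isHomogeneous_X_pow _ _)
  obtain ⟨f1, hf1⟩ := hgen.2 _ (alpha_smul_mem (φ := φ) hψ1)
  obtain ⟨f2, hf2⟩ := hgen.2 _ (alpha_smul_mem (φ := φ) hψ2)
  rw [← hα] at hf1 hf2
  have hdiff : R.σ g2 • ψ1 - R.σ g1 • ψ2 ∈ DM (insert (LinearMap.ker φ) A) := by
    rw [test_mem R]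
    refine ⟨Submodule.sub_mem _ (Submodule.smul_mem _ _ hψ1) (Submodule.smul_mem _ _ hψ2), ?_⟩
    rw [rho_sub, rho_smul, rho_smul, R.ρσ, R.ρσ, he1, he2]
    ring
  obtain ⟨c0, hc0⟩ := hgen.2 _ hdiff
  have hrel : ∀ i, R.σ g2 * f1 i - R.σ g1 * f2 i - α * c0 i = 0 := by
    apply hind
    simp only [sub_smul, mul_smul, Finset.sum_sub_distrib, ← Finset.smul_sum]
    rw [← hf1, ← hf2, ← hc0, smul_sub, smul_comm α, smul_comm α, sub_self]
  have hdv : ∀ i, g1 ∣ R.ρ (f1 i) := by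
    intro i
    have h := congrArg R.ρ (hrel i)
    simp only [map_sub, map_mul, R.ρσ, hρα, zero_mul, sub_zero, map_zero] at h
    apply (X_pow_relPrime A.card).dvd_of_dvd_mul_left (z := R.ρ (f1 i))
    exact ⟨R.ρ (f2 i), sub_eq_zero.1 h⟩
  choose c hc using hdv
  have hz : ∀ k, α ∣ (∑ i, R.σ (c i) • θ i) k := by
    intro k
    rw [← R.ker]
    have h := congrArg R.ρ (congrFun hf1 k)
    simp only [Pi.smul_apply, smul_eq_mul, map_mul, hρα, zero_mul, Finset.sum_apply, map_sum, hc] at h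
    simp only [Finset.sum_apply, Pi.smul_apply, smul_eq_mul, map_mul, map_sum, R.ρσ]
    simp only [mul_assoc, ← Finset.mul_sum] at h
    exact (mul_eq_zero.1 h.symm).resolve_left hg10
  choose Φ hΦ using hz
  have hΦ' : α • Φ = ∑ i, R.σ (c i) • θ i := by
    funext k
    rw [hΦ k]; rfl
  have hΦm : Φ ∈ DM A := by
    apply mem_of_alpha hA hφ hn
    rw [← hα, hΦ']
    apply Submodule.sum_mem
    intro i _
    apply Submodule.smul_mem
    exact ((test_mem R).1 (hgen.1 i)).1
  have hdiff2 : R.σ g1 • Φ - ψ1 ∈ DM (insert (LinearMap.ker φ) A) := by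
    have : ∀ i, α ∣ R.σ g1 * R.σ (c i) - f1 i := by
      intro i
      rw [← R.ker, map_sub, map_mul, R.ρσ, R.ρσ, hc, sub_self]
    choose c' hc' using this
    have : R.σ g1 • Φ - ψ1 = ∑ i, c' i • θ i := by
      apply smul_cancel hα0
      rw [smul_sub, smul_comm α, hΦ', hf1, Finset.smul_sum, Finset.smul_sum, ← Finset.sum_sub_distrib]
      apply Finset.sum_congr rfl
      intro i _
      rw [smul_smul, smul_smul, ← hc', sub_smul]
    rw [this]
    exact Submodule.sum_mem _ fun i _ => Submodule.smul_mem _ _ (hgen.1 i)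
  have h3 := ((test_mem R).1 hdiff2).2
  rw [rho_sub, rho_smul, R.ρσ, he1, mul_comm B, ← mul_sub] at h3
  have h4 := sub_eq_zero.1 ((mul_eq_zero.1 h3).resolve_left hg10)
  refine ⟨hcD d Φ, hcD_mem hΦm _, hcD_homog _ _, ?_⟩
  rw [hcD_apply, ← hc_map R.ρ R.hρ, h4, hc_self hBd]

lemma free_to_spog {A : Finset (Submodule K (Fin 3 → K))} (hA : IsArrangement A)
    {φ : Module.Dual K (Fin 3 → K)} (hφ : φ ≠ 0) (hn : LinearMap.ker φ ∉ A) (R : Restr φ)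
    {B : MvPolynomial (Fin 2) K} {d : ℕ} (hB0 : B ≠ 0) (hBd : B.IsHomogeneous d)
    (hdvd : ∀ θ ∈ DM A, B ∣ R.ρ (applyLin θ φ))
    (hsurj : ∀ (m : ℕ) (g : MvPolynomial (Fin 2) K), A.card ≤ m + 1 → g.IsHomogeneous m →
        ∃ θ ∈ DM A, HomogDeriv θ (m + d) ∧ R.ρ (applyLin θ φ) = B * g)
    {e : Fin 3 → ℕ} (hfree : IsFreeExp (insert (LinearMap.ker φ) A) e) (hnf : ¬ IsFree A) :
    IsSPOG A e d := by
  obtain ⟨θ, hhom, hgen, hind⟩ := hfree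
  obtain ⟨Φ, hΦm, hΦh, hΦB⟩ := exists_gen hA hφ hn R hBd hsurj θ hgen hind
  set α := linPoly φ with hα
  have hα0 : α ≠ 0 := fun h => hφ (linPoly_eq_zero h)
  have hρα : R.ρ α = 0 := (R.ker _).2 dvd_rfl
  obtain ⟨f0, hf0⟩ := hgen.2 _ (alpha_smul_mem (φ := φ) hΦm)
  rw [← hα] at hf0
  set f := fun i => hcs (d+1) (e i) (f0 i) with hfdef
  have hf : α • Φ = ∑ i, f i • θ i := by
    have h1 : HomogDeriv (α • Φ) (d + 1) := by
      intro i
      have := (linPoly_homog φ).mul (hΦh i)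
      rw [add_comm] at this
      exact this
    rw [← hcD_self h1, hf0, hcD_sum]
    exact Finset.sum_congr rfl fun i _ => hcD_smul (hhom i) _
  have hθA : ∀ i, θ i ∈ DM A := fun i => ((test_mem R).1 (hgen.1 i)).1
  have hθ0 : ∀ i, R.ρ (applyLin (θ i) φ) = 0 := fun i => ((test_mem R).1 (hgen.1 i)).2
  have hgenA : ∀ η, InD A η → ∃ (c : Fin 3 → MvPolynomial (Fin 3) K) (g : MvPolynomial (Fin 3) K),
      η = (∑ i, c i • θ i) + g • Φ := by
    intro η hη
    obtain ⟨g, hg⟩ := hdvd η hη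
    have : η - R.σ g • Φ ∈ DM (insert (LinearMap.ker φ) A) := by
      rw [test_mem R]
      refine ⟨Submodule.sub_mem _ hη (Submodule.smul_mem _ _ hΦm), ?_⟩
      rw [rho_sub, rho_smul, R.ρσ, hg, hΦB]
      ring
    obtain ⟨c, hc⟩ := hgen.2 _ this
    exact ⟨c, R.σ g, by rw [← hc]; abel⟩
  have hsyz : ∀ (g : Fin 3 → MvPolynomial (Fin 3) K) (h : MvPolynomial (Fin 3) K),
      ((∑ i, g i • θ i) + h • Φ = 0) →
      ∃ q : MvPolynomial (Fin 3) K, (∀ i, g i = q * (- f i)) ∧ h = q * α := by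
    intro g h hgh
    have h1 : R.ρ (applyLin ((∑ i, g i • θ i) + h • Φ) φ) = 0 := by
      rw [hgh, ← appl_apply, map_zero, map_zero]
    rw [rho_add, rho_sum, rho_smul, hΦB] at h1
    simp only [rho_smul, hθ0, mul_zero, Finset.sum_const_zero, zero_add] at h1
    have h2 := (mul_eq_zero.1 h1).resolve_right hB0
    obtain ⟨q, hq⟩ := (R.ker h).1 h2
    rw [← hα] at hq
    refine ⟨q, ?_, by rw [hq, mul_comm]⟩
    have : ∀ i, g i + q * f i = 0 := by
      apply hind
      simp only [add_smul, mul_smul, Finset.sum_add_distrib, ← Finset.smul_sum]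
      rw [← hf, smul_smul, mul_comm q, ← hq, hgh]
    intro i
    have := this i
    linear_combination this
  have hfh : ∀ i, (f i).IsHomogeneous (d + 1 - e i) := fun i => hcs_homog _ _ _
  have hcc : ∀ i, constantCoeff (f i) = 0 := by
    intro i
    by_contra hne
    apply hnf
    have hdeg : d + 1 - e i = 0 := by
      by_contra h0
      apply hne
      apply (hfh i).coeff_eq_zero
      simpa using Ne.symm h0
    obtain ⟨u, hu⟩ : ∃ u, f i = C u := by
      have := hfh i
      rw [hdeg] at this
      rw [← totalDegree_zero_iff_isHomogeneous] at this
      exact ⟨_, totalDegree_eq_zero_iff_eq_C.1 this⟩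
    have hu0 : u ≠ 0 := by
      rintro rfl
      simp [hu] at hne
    have hCu : (C u⁻¹ : MvPolynomial (Fin 3) K) * C u = 1 := by
      rw [← C_mul, inv_mul_cancel₀ hu0, C_1]
    have split : ∀ F : Fin 3 → Deriv K 3, ∑ j, F j = F i + ∑ j ∈ Finset.univ.erase i, F j :=
      fun F => (Finset.add_sum_erase _ _ (Finset.mem_univ i)).symm
    have hupd : ∀ g : Fin 3 → MvPolynomial (Fin 3) K, ∑ j, g j • (Function.update θ i Φ) j
        = g i • Φ + ∑ j ∈ Finset.univ.erase i, g j • θ j := by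
      intro g
      rw [split, Function.update_self]
      congr 1
      apply Finset.sum_congr rfl
      intro j hj
      rw [Function.update_of_ne (Finset.ne_of_mem_erase hj)]
    refine ⟨Function.update e i d, Function.update θ i Φ, ?_, ⟨?_, ?_⟩, ?_⟩
    · intro j
      by_cases hj : j = i
      · subst hj; simpa using hΦh
      · simpa [hj] using hhom j
    · intro j
      by_cases hj : j = i
      · subst hj; rw [Function.update_self]; exact hΦm
      · rw [Function.update_of_ne hj]; exact hθA j
    · intro η hη
      obtain ⟨c, g, hcg⟩ := hgenA η hη
      refine ⟨fun j => if j = i then g + c i * C u⁻¹ * α else c j - c i * C u⁻¹ * f j, ?_⟩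
      rw [hupd]
      have h1 : ∑ j ∈ Finset.univ.erase i, (if j = i then g + c i * C u⁻¹ * α else c j - c i * C u⁻¹ * f j) • θ j
          = ∑ j ∈ Finset.univ.erase i, c j • θ j - (c i * C u⁻¹) • ∑ j ∈ Finset.univ.erase i, f j • θ j := by
        rw [Finset.smul_sum, ← Finset.sum_sub_distrib]
        apply Finset.sum_congr rfl
        intro j hj
        rw [if_neg (Finset.ne_of_mem_erase hj), sub_smul, mul_smul _ (f j)]
      rw [h1, if_pos rfl, hcg, split]
      have h2 := hf
      rw [split, hu] at h2
      have h3 : ∑ j ∈ Finset.univ.erase i, f j • θ j = α • Φ - (C u : MvPolynomial (Fin 3) K) • θ i := by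
        rw [h2]; abel
      rw [h3, smul_sub, smul_smul, smul_smul, mul_assoc (c i) (C u⁻¹) (C u), hCu, mul_one, add_smul]
      abel
    · intro g hg
      rw [hupd] at hg
      obtain ⟨q, hq1, hq2⟩ := hsyz (Function.update g i 0) (g i) (by
        rw [split, Function.update_self, zero_smul, zero_add, ← hg, add_comm]
        congr 1
        apply Finset.sum_congr rfl
        intro j hj
        rw [Function.update_of_ne (Finset.ne_of_mem_erase hj)])
      have hq : q = 0 := by
        have := hq1 i
        rw [Function.update_self, hu] at this
        have h4 : (C u : MvPolynomial (Fin 3) K) ≠ 0 := by simpa using hu0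
        have h5 := mul_eq_zero.1 this.symm
        rcases h5 with h5 | h5
        · exact h5
        · exact absurd (neg_eq_zero.1 h5) h4
      intro j
      by_cases hj : j = i
      · subst hj; rw [hq2, hq, zero_mul]
      · have := hq1 j
        rw [Function.update_of_ne hj] at this
        rw [this, hq, zero_mul]
  refine ⟨θ, Φ, fun i => - f i, α, ⟨hθA, hΦm, hhom, hΦh, hgenA, linPoly_homog φ, ?_, ?_, ?_, ?_, hsyz⟩, hα0⟩
  · exact fun i => (hfh i).neg
  · intro i
    simp [hcc]
  · rw [hf]
    simp
  · rintro ⟨h, -⟩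
    exact hα0 h



lemma const_of_cc {σ : Type} {f : MvPolynomial σ K} {n : ℕ} (h : f.IsHomogeneous n)
    (hc : constantCoeff f ≠ 0) : f = C (constantCoeff f) := by
  have hn : n = 0 := by
    by_contra h0
    apply hc
    apply h.coeff_eq_zero
    simpa using Ne.symm h0
  subst hn
  rw [← totalDegree_zero_iff_isHomogeneous] at h
  exact totalDegree_eq_zero_iff_eq_C.1 h

lemma zero_of_cc {σ : Type} {f : MvPolynomial σ K} (h : f.IsHomogeneous 0)
    (hc : constantCoeff f = 0) : f = 0 := by
  rw [← totalDegree_zero_iff_isHomogeneous] at h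
  have := totalDegree_eq_zero_iff_eq_C.1 h
  rw [this]
  have h2 : coeff 0 f = 0 := hc
  rw [h2, C_0]

lemma cc_pos {σ : Type} {f : MvPolynomial σ K} {n : ℕ} (h : f.IsHomogeneous n) (hn : n ≠ 0) :
    constantCoeff f = 0 := by
  apply h.coeff_eq_zero
  simpa using Ne.symm hn

lemma pog_primitive {A : Finset (Submodule K (Fin 3 → K))} {e : Fin 3 → ℕ} {d : ℕ}
    {θ : Fin 3 → Deriv K 3} {Φ : Deriv K 3} {f : Fin 3 → MvPolynomial (Fin 3) K}
    {α : MvPolynomial (Fin 3) K} (P : IsPOGWith A e d θ Φ f α)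
    {p : MvPolynomial (Fin 3) K} (h1 : ∀ i, p ∣ f i) (h2 : p ∣ α) : IsUnit p := by
  obtain ⟨-, -, -, -, -, -, -, -, hrel, hne, hsyz⟩ := P
  choose g hg using h1
  obtain ⟨h, hh⟩ := h2
  have hp : p ≠ 0 := by
    rintro rfl
    apply hne
    simp [hg, hh]
  obtain ⟨q, hq1, hq2⟩ := hsyz g h (by
    apply smul_cancel hp
    rw [smul_zero, ← hrel, smul_add, Finset.smul_sum, smul_smul, ← hh]
    congr 1
    exact Finset.sum_congr rfl fun i _ => by rw [smul_smul, ← hg])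
  have key : ∀ x : MvPolynomial (Fin 3) K, x ≠ 0 → x = p * (q * x) → IsUnit p := by
    intro x hx hxe
    apply IsUnit.of_mul_eq_one q
    apply mul_right_cancel₀ hx
    rw [one_mul, mul_assoc, ← hxe]
  by_cases hα : α = 0
  · have : ∃ i, f i ≠ 0 := by
      by_contra hcon
      push Not at hcon
      exact hne ⟨hα, hcon⟩
    obtain ⟨i, hi⟩ := this
    exact key _ hi (by rw [← hq1, ← hg])
  · exact key _ hα (by rw [← hq2, ← hh])

lemma psi_contra {A : Finset (Submodule K (Fin 3 → K))} (hA : IsArrangement A) {e : Fin 3 → ℕ} {d : ℕ}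
    {θ : Fin 3 → Deriv K 3} {Φ : Deriv K 3} {f : Fin 3 → MvPolynomial (Fin 3) K}
    {α : MvPolynomial (Fin 3) K} (P : IsPOGWith A e d θ Φ f α)
    {i j : Fin 3} (hij : i ≠ j) {s p q : MvPolynomial (Fin 3) K} {η : Deriv K 3} (hη : η ∈ DM A)
    (hpq : IsRelPrime p q) (hp : constantCoeff p = 0) (hq : constantCoeff q = 0)
    (h : p • (θ j - s • θ i) + q • η = 0) : False := by
  obtain ⟨hθ, -, -, -, hgen, -, -, hcc, -, -, hsyz⟩ := P
  have hq0 : q ≠ 0 := by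
    rintro rfl
    have hu := isRelPrime_zero_right.1 hpq
    have := hu.map (constantCoeff (σ := Fin 3) (R := K))
    rw [hp] at this
    exact not_isUnit_zero this
  have hdv : ∀ k, q ∣ (θ j - s • θ i) k := by
    intro k
    apply hpq.symm.dvd_of_dvd_mul_left
    have := congrFun h k
    simp only [Pi.add_apply, Pi.smul_apply, smul_eq_mul, Pi.zero_apply] at this
    exact ⟨- η k, by linear_combination this⟩
  choose ψ hψ using hdv
  have h1 : θ j - s • θ i = q • ψ := funext hψ
  have h2 : p • ψ = - η := by
    apply smul_cancel hq0
    rw [smul_comm, ← h1, smul_neg]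
    exact eq_neg_of_add_eq_zero_left h
  have hψm : ψ ∈ DM A := by
    apply mem_of_relPrime hA hpq
    · rw [h2]; exact Submodule.neg_mem _ hη
    · rw [← h1]; exact Submodule.sub_mem _ (hθ j) (Submodule.smul_mem _ _ (hθ i))
  obtain ⟨c, g, hcg⟩ := hgen ψ hψm
  obtain ⟨u, hu1, -⟩ := hsyz (fun k => q * c k - (if k = j then 1 else 0) + (if k = i then s else 0)) (q * g) (by
    simp only [add_smul, sub_smul, mul_smul, Finset.sum_add_distrib, Finset.sum_sub_distrib, ite_smul, zero_smul,
      one_smul, Finset.sum_ite_eq', Finset.mem_univ, if_true]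
    rw [← Finset.smul_sum]
    have : q • ∑ i, c i • θ i + q • g • Φ = θ j - s • θ i := by
      rw [← smul_add, ← hcg, h1]
    rw [eq_sub_iff_add_eq] at this
    rw [← this]; abel)
  have := congrArg constantCoeff (hu1 j)
  simp [hq, hcc, hij.symm] at this

lemma level_pos {A : Finset (Submodule K (Fin 3 → K))} {e : Fin 3 → ℕ} {d : ℕ}
    {θ : Fin 3 → Deriv K 3} {Φ : Deriv K 3} {f : Fin 3 → MvPolynomial (Fin 3) K}
    {α : MvPolynomial (Fin 3) K} (P : IsPOGWith A e d θ Φ f α) (hα : α ≠ 0) : d ≠ 0 := by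
  rintro rfl
  obtain ⟨-, -, hθ, hΦ, -, hα1, hfh, hcc, hrel, -, hsyz⟩ := P
  obtain ⟨m, hm⟩ : ∃ m, coeff m α ≠ 0 := by
    by_contra hcon
    push Not at hcon
    exact hα (MvPolynomial.ext _ _ (by simpa using hcon))
  have key : ∀ (g w : MvPolynomial (Fin 3) K), w.IsHomogeneous 0 → C (coeff m (g * w)) = C (coeff m g) * w := by
    intro g w hw
    have : w = C (coeff 0 w) := by
      rw [← totalDegree_zero_iff_isHomogeneous] at hw
      exact totalDegree_eq_zero_iff_eq_C.1 hw
    rw [this, mul_comm g, coeff_C_mul, C_mul, mul_comm]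
  obtain ⟨q, -, hq⟩ := hsyz (fun i => C (coeff m (f i))) (C (coeff m α)) (by
    funext k
    have h := congrArg (fun x => (C (coeff m x) : MvPolynomial (Fin 3) K)) (congrFun hrel k)
    simp only [Pi.add_apply, Finset.sum_apply, Pi.smul_apply, smul_eq_mul, Pi.zero_apply, coeff_add,
      coeff_sum, coeff_zero, C_0, C_add, map_sum] at h ⊢
    rw [key _ _ (hΦ k)] at h
    rw [← h]
    congr 1
    apply Finset.sum_congr rfl
    intro i _
    by_cases he : e i = 0
    · rw [key]
      have := hθ i k
      rwa [he] at this
    · have : f i = 0 := by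
        apply zero_of_cc _ (hcc i)
        have := hfh i
        rwa [show 0 + 1 - e i = 0 by omega] at this
      simp [this])
  have := congrArg constantCoeff hq
  simp [cc_pos hα1 one_ne_zero] at this
  exact hm this

lemma Bquot {n : ℕ} {B u : MvPolynomial (Fin n) K} {d e : ℕ} (hB : B.IsHomogeneous d) (hu : u.IsHomogeneous e)
    (h : B ∣ u) : ∃ t, u = B * t ∧ t.IsHomogeneous (e - d) ∧ (e < d → t = 0) := by
  obtain ⟨t, rfl⟩ := h
  refine ⟨hcs e d t, ?_, hcs_homog _ _ _, ?_⟩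
  · rw [mul_comm B (hcs e d t), ← hcs_mul hB, mul_comm t, hc_self hu]
  · intro h
    unfold hcs
    rw [if_neg (by omega)]

lemma pog_shift {A : Finset (Submodule K (Fin 3 → K))} {e : Fin 3 → ℕ} {d : ℕ}
    {θ : Fin 3 → Deriv K 3} {Φ : Deriv K 3} {f : Fin 3 → MvPolynomial (Fin 3) K}
    {α : MvPolynomial (Fin 3) K} (P : IsPOGWith A e d θ Φ f α)
    {s : Fin 3 → MvPolynomial (Fin 3) K} (hs : ∀ i, (s i).IsHomogeneous (e i - d))
    (hs0 : ∀ i, e i < d → s i = 0) :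
    IsPOGWith A e d (fun i => θ i - s i • Φ) Φ f (α + ∑ i, f i * s i) := by
  obtain ⟨hθ, hΦ, hθh, hΦh, hgen, hα1, hfh, hcc, hrel, hne, hsyz⟩ := P
  have hexp : ∀ c : Fin 3 → MvPolynomial (Fin 3) K, ∑ i, c i • (θ i - s i • Φ) =
      ∑ i, c i • θ i - (∑ i, c i * s i) • Φ := by
    intro c
    rw [Finset.sum_smul, ← Finset.sum_sub_distrib]
    exact Finset.sum_congr rfl fun i _ => by rw [smul_sub, smul_smul]
  have hsy : ∀ (g : Fin 3 → MvPolynomial (Fin 3) K) (h : MvPolynomial (Fin 3) K),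
      ((∑ i, g i • (θ i - s i • Φ)) + h • Φ = 0) →
      ∃ q : MvPolynomial (Fin 3) K, (∀ i, g i = q * f i) ∧ h = q * (α + ∑ i, f i * s i) := by
    intro g h hgh
    obtain ⟨q, hq1, hq2⟩ := hsyz g (h - ∑ i, g i * s i) (by
      rw [← hgh, hexp, sub_smul]; abel)
    refine ⟨q, hq1, ?_⟩
    rw [mul_add, ← hq2, Finset.mul_sum]
    simp only [hq1, mul_assoc]
    ring
  refine ⟨?_, hΦ, ?_, hΦh, ?_, ?_, hfh, hcc, ?_, ?_, hsy⟩
  · intro i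
    exact Submodule.sub_mem (DM A) (hθ i) (Submodule.smul_mem _ _ hΦ)
  · intro i k
    by_cases h : e i < d
    · simp only [hs0 i h, zero_smul, sub_zero]
      exact hθh i k
    · refine (hθh i k).sub ?_
      have := (hs i).mul (hΦh k)
      rwa [show e i - d + d = e i by omega] at this
  · intro η hη
    obtain ⟨c, g, hcg⟩ := hgen η hη
    refine ⟨c, g + ∑ i, c i * s i, ?_⟩
    rw [hexp, hcg, add_smul]; abel
  · refine hα1.add (IsHomogeneous.sum _ _ _ ?_)
    intro i _
    by_cases h : e i < d
    · rw [hs0 i h, mul_zero]; exact isHomogeneous_zero _ _ _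
    · by_cases h2 : e i = d
      · have := (hfh i).mul (hs i)
        rwa [show d + 1 - e i + (e i - d) = 1 by omega] at this
      · have : f i = 0 := by
          apply zero_of_cc _ (hcc i)
          have := hfh i
          rwa [show d + 1 - e i = 0 by omega] at this
        rw [this, zero_mul]; exact isHomogeneous_zero _ _ _
  · rw [hexp, add_smul, ← hrel]; abel
  · rintro ⟨h1, h2⟩
    apply hne
    refine ⟨?_, h2⟩
    simpa [h2] using h1

lemma euler_mem (A : Finset (Submodule K (Fin 3 → K))) : (eulerD : Deriv K 3) ∈ DM A :=
  fun _ _ φ _ => dvd_of_eq (by rfl)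

lemma free_of_zero {A : Finset (Submodule K (Fin 3 → K))} (hA : IsArrangement A)
    {φ : Module.Dual K (Fin 3 → K)} (hφ : φ ≠ 0) (R : Restr φ)
    {u : MvPolynomial (Fin 2) K} (hu : u ≠ 0)
    {e : Fin 3 → ℕ} {d : ℕ} (hd : d ≠ 0)
    {θ : Fin 3 → Deriv K 3} {Φ : Deriv K 3} {f : Fin 3 → MvPolynomial (Fin 3) K}
    {α : MvPolynomial (Fin 3) K} (P : IsPOGWith A e d θ Φ f α)
    (hθ0 : ∀ i, R.ρ (applyLin (θ i) φ) = 0) (hΦu : R.ρ (applyLin Φ φ) = u) :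
    IsFreeExp (insert (LinearMap.ker φ) A) e := by
  have P' := P
  obtain ⟨hθ, hΦ, hθh, hΦh, hgen, hα1, hfh, hcc, hrel, hne, hsyz⟩ := P
  set β := linPoly φ with hβ
  have hβ0 : β ≠ 0 := fun h => hφ (linPoly_eq_zero h)
  have hco : ∀ (c : Fin 3 → MvPolynomial (Fin 3) K) (g : MvPolynomial (Fin 3) K),
      R.ρ (applyLin ((∑ i, c i • θ i) + g • Φ) φ) = 0 → ∃ g', g = β * g' := by
    intro c g h
    rw [rho_add, rho_sum, rho_smul, hΦu] at h
    simp only [rho_smul, hθ0, mul_zero, Finset.sum_const_zero, zero_add] at h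
    exact (R.ker g).1 ((mul_eq_zero.1 h).resolve_right hu)
  have hz0 : R.ρ (applyLin (0 : Deriv K 3) φ) = 0 := by rw [← appl_apply, map_zero, map_zero]
  obtain ⟨t, ht⟩ := hco f α (by rw [hrel, hz0])
  have hα' : α = C (coeff 0 t) * β := by
    rw [← hc_self hα1, ht, mul_comm, hcs_mul (linPoly_homog φ)]
    simp [hcs, hβ]
  by_cases hc0 : coeff 0 t = 0
  · exfalso
    have hα0 : α = 0 := by rw [hα', hc0, C_0, zero_mul]
    have hr : ∀ i, ∃ r, applyLin (θ i) φ = β * r ∧ r.IsHomogeneous (e i - 1) := by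
      intro i
      obtain ⟨r, h1, h2, -⟩ := Bquot (linPoly_homog φ) (appl_homog φ (hθh i)) ((R.ker _).1 (hθ0 i))
      exact ⟨r, h1, h2⟩
    choose r hr1 hr2 using hr
    have happ : ∀ (c : Fin 3 → MvPolynomial (Fin 3) K) (g : MvPolynomial (Fin 3) K),
        applyLin ((∑ i, c i • θ i) + g • Φ) φ = β * (∑ i, c i * r i) + g * applyLin Φ φ := by
      intro c g
      rw [← appl_apply, map_add, map_smul, map_sum]
      simp only [map_smul, appl_apply, hr1, smul_eq_mul, Finset.mul_sum]
      congr 1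
      exact Finset.sum_congr rfl fun i _ => by ring
    have hfr : ∑ i, f i * r i = 0 := by
      have h := happ f α
      rw [hrel, hα0, zero_mul, add_zero, ← appl_apply, map_zero] at h
      exact (mul_eq_zero.1 h.symm).resolve_left hβ0
    obtain ⟨c, g, hcg⟩ := hgen _ (euler_mem A)
    have hE : applyLin (eulerD : Deriv K 3) φ = β := rfl
    obtain ⟨g', hg'⟩ := hco c g (by rw [← hcg, hE]; exact (R.ker _).2 dvd_rfl)
    have hone : 1 = ∑ i, c i * r i + g' * applyLin Φ φ := by
      apply mul_left_cancel₀ hβ0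
      have := happ c g
      rw [← hcg, hE, hg'] at this
      rw [mul_one, mul_add, ← mul_assoc, ← this]
    obtain ⟨i, hi⟩ : ∃ i, constantCoeff (r i) ≠ 0 := by
      by_contra hcon
      push Not at hcon
      have h := congrArg constantCoeff hone
      rw [map_add, map_sum, map_mul constantCoeff g', cc_pos (appl_homog φ hΦh) hd] at h
      simp [hcon] at h
    have hri := const_of_cc (hr2 i) hi
    set w := constantCoeff (r i) with hw
    have hCw : (C w⁻¹ : MvPolynomial (Fin 3) K) * C w = 1 := by
      rw [← C_mul, inv_mul_cancel₀ hi, C_1]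
    obtain ⟨j, k, hij, hik, hjk, hall⟩ : ∃ j k : Fin 3, i ≠ j ∧ i ≠ k ∧ j ≠ k ∧ ∀ l, l = i ∨ l = j ∨ l = k := by
      clear * -
      fin_cases i
      · exact ⟨1, 2, by simp, by simp, by simp, fun l => by fin_cases l <;> simp⟩
      · exact ⟨0, 2, by simp, by simp, by simp, fun l => by fin_cases l <;> simp⟩
      · exact ⟨0, 1, by simp, by simp, by simp, fun l => by fin_cases l <;> simp⟩
    have huniv : (Finset.univ : Finset (Fin 3)) = {i, j, k} := by
      ext l; simpa using hall l
    have hsum : ∀ {M : Type} [AddCommMonoid M] (F : Fin 3 → M), ∑ l, F l = F i + (F j + F k) := by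
      intro M _ F
      rw [huniv, Finset.sum_insert (by simp [hij, hik]), Finset.sum_pair hjk]
    rw [hsum, hri] at hfr
    have hfi : f i = - (C w⁻¹ * (f j * r j + f k * r k)) := by
      linear_combination (C w⁻¹) * hfr - f i * hCw
    apply psi_contra hA P' hij (s := C w⁻¹ * r j) (p := f j) (q := f k)
      (η := θ k - (C w⁻¹ * r k) • θ i)
    · exact Submodule.sub_mem _ (hθ k) (Submodule.smul_mem _ _ (hθ i))
    · intro p hpj hpk
      apply pog_primitive P'
      · intro l
        rcases hall l with rfl | rfl | rfl
        · rw [hfi]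
          exact (dvd_neg).2 (Dvd.dvd.mul_left (dvd_add (hpj.mul_right _) (hpk.mul_right _)) _)
        · exact hpj
        · exact hpk
      · rw [hα0]; exact dvd_zero _
    · exact hcc j
    · exact hcc k
    · rw [hsum, hα0, zero_smul, add_zero, hfi] at hrel
      rw [← hrel]
      simp only [smul_sub, smul_smul, neg_smul]
      rw [show C w⁻¹ * (f j * r j + f k * r k) = f j * (C w⁻¹ * r j) + f k * (C w⁻¹ * r k) by ring, add_smul]
      abel
  · set c' := coeff 0 t with hc'
    have hCw : (C c'⁻¹ : MvPolynomial (Fin 3) K) * C c' = 1 := by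
      rw [← C_mul, inv_mul_cancel₀ hc0, C_1]
    have hα0 : α ≠ 0 := by
      rw [hα']
      exact mul_ne_zero (by simpa using hc0) hβ0
    refine ⟨θ, hθh, ⟨?_, ?_⟩, ?_⟩
    · intro i
      exact (test_mem R).2 ⟨hθ i, hθ0 i⟩
    · intro η hη
      obtain ⟨h1, h2⟩ := (test_mem R).1 hη
      obtain ⟨c, g, hcg⟩ := hgen η h1
      obtain ⟨g', hg'⟩ := hco c g (by rw [← hcg, h2])
      have hg2 : g = C c'⁻¹ * g' * α := by
        rw [hg', hα']; linear_combination (- g' * β) * hCw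
      refine ⟨fun i => c i - C c'⁻¹ * g' * f i, ?_⟩
      simp only [sub_smul, mul_smul _ (f _), Finset.sum_sub_distrib, ← Finset.smul_sum]
      rw [hcg, hg2, eq_neg_of_add_eq_zero_left hrel, smul_neg, smul_smul, sub_neg_eq_add]
    · intro c hc i
      obtain ⟨q, hq1, hq2⟩ := hsyz c 0 (by rw [hc, zero_smul, add_zero])
      have hq : q = 0 := (mul_eq_zero.1 hq2.symm).resolve_right hα0
      rw [hq1, hq, zero_mul]

lemma free_of_const {A : Finset (Submodule K (Fin 3 → K))} (hA : IsArrangement A)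
    {φ : Module.Dual K (Fin 3 → K)} (hφ : φ ≠ 0) (R : Restr φ)
    {B : MvPolynomial (Fin 2) K} (hB0 : B ≠ 0)
    {e : Fin 3 → ℕ} {d : ℕ} (hd : d ≠ 0) (hBd : B.IsHomogeneous d)
    (hdvd : ∀ θ ∈ DM A, B ∣ R.ρ (applyLin θ φ))
    {θ : Fin 3 → Deriv K 3} {Φ : Deriv K 3} {f : Fin 3 → MvPolynomial (Fin 3) K}
    {α : MvPolynomial (Fin 3) K} (P : IsPOGWith A e d θ Φ f α)
    {c : K} (hc : c ≠ 0) (hΦu : R.ρ (applyLin Φ φ) = B * C c) :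
    IsFreeExp (insert (LinearMap.ker φ) A) e := by
  have hh : ∀ i, ∃ t, R.ρ (applyLin (θ i) φ) = B * t ∧ t.IsHomogeneous (e i - d) ∧ (e i < d → t = 0) :=
    fun i => Bquot hBd (R.hρ _ _ (appl_homog φ (P.2.2.1 i))) (hdvd _ (P.1 i))
  choose h h1 h2 h3 using hh
  have hCw : (C c⁻¹ : MvPolynomial (Fin 2) K) * C c = 1 := by
    rw [← C_mul, inv_mul_cancel₀ hc, C_1]
  have P2 := pog_shift P (s := fun i => R.σ (C c⁻¹ * h i))
    (fun i => R.hσ _ _ ((h2 i).C_mul _)) (fun i hi => by rw [h3 i hi, mul_zero, map_zero])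
  refine free_of_zero hA hφ R (u := B * C c) (mul_ne_zero hB0 (by simpa using hc)) hd P2 ?_ hΦu
  intro i
  simp only [rho_sub, rho_smul, R.ρσ, h1, hΦu]
  linear_combination (- B * h i) * hCw

lemma spog_to_free {A : Finset (Submodule K (Fin 3 → K))} (hA : IsArrangement A)
    {φ : Module.Dual K (Fin 3 → K)} (hφ : φ ≠ 0) (R : Restr φ)
    {B : MvPolynomial (Fin 2) K} {d : ℕ} (hB0 : B ≠ 0) (hBd : B.IsHomogeneous d)
    (hdvd : ∀ θ ∈ DM A, B ∣ R.ρ (applyLin θ φ))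
    (hsurj : ∀ (m : ℕ) (g : MvPolynomial (Fin 2) K), A.card ≤ m + 1 → g.IsHomogeneous m →
        ∃ θ ∈ DM A, HomogDeriv θ (m + d) ∧ R.ρ (applyLin θ φ) = B * g)
    {e : Fin 3 → ℕ} (he : e 0 = 1) (hs : IsSPOG A e d) :
    IsFreeExp (insert (LinearMap.ker φ) A) e := by
  obtain ⟨θ, Φ, f, α, P, hα0⟩ := hs
  have hd := level_pos P hα0
  have P' := P
  obtain ⟨hθ, hΦ, hθh, hΦh, hgen, hα1, hfh, hcc, hrel, hne, hsyz⟩ := P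
  have hh : ∀ i, ∃ t, R.ρ (applyLin (θ i) φ) = B * t ∧ t.IsHomogeneous (e i - d) ∧ (e i < d → t = 0) :=
    fun i => Bquot hBd (R.hρ _ _ (appl_homog φ (hθh i))) (hdvd _ (hθ i))
  choose h h1 h2 h3 using hh
  obtain ⟨t, ht1, ht2, -⟩ := Bquot hBd (R.hρ _ _ (appl_homog φ hΦh)) (hdvd _ hΦ)
  rw [Nat.sub_self] at ht2
  by_cases hct : constantCoeff t = 0
  swap
  · rw [const_of_cc ht2 hct] at ht1
    exact free_of_const hA hφ R hB0 hd hBd hdvd P' hct ht1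
  have ht0 := zero_of_cc ht2 hct
  rw [ht0, mul_zero] at ht1
  by_cases hex : ∃ i, constantCoeff (h i) ≠ 0
  · obtain ⟨i, hi⟩ := hex
    have hei : e i = d := by
      rcases lt_trichotomy (e i) d with hl | hl | hl
      · rw [h3 i hl, map_zero] at hi; exact absurd rfl hi
      · exact hl
      · exact absurd (cc_pos (h2 i) (by omega)) hi
    have hhi := const_of_cc (h2 i) hi
    have P2 : IsPOGWith A e d θ (Φ + θ i) (fun j => f j - (if j = i then α else 0)) α := by
      have hexp : ∀ (c : Fin 3 → MvPolynomial (Fin 3) K) (x : MvPolynomial (Fin 3) K),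
          ∑ j, (c j - if j = i then x else 0) • θ j + x • (Φ + θ i) = ∑ j, c j • θ j + x • Φ := by
        intro c x
        simp only [sub_smul, Finset.sum_sub_distrib, ite_smul, zero_smul, Finset.sum_ite_eq',
          Finset.mem_univ, if_true, smul_add]
        abel
      refine ⟨hθ, Submodule.add_mem (DM A) hΦ (hθ i), hθh, ?_, ?_, hα1, ?_, ?_, ?_, ?_, ?_⟩
      · intro k
        have := hθh i k
        rw [hei] at this
        exact (hΦh k).add this
      · intro η hη
        obtain ⟨c, g, hcg⟩ := hgen η hη
        exact ⟨fun j => c j - if j = i then g else 0, g, by rw [hexp, hcg]⟩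
      · intro j
        beta_reduce
        by_cases hj : j = i
        · subst hj
          have h5 := hfh j
          rw [if_pos rfl]
          rw [hei, show d + 1 - d = 1 by omega] at h5 ⊢
          exact h5.sub hα1
        · rw [if_neg hj, sub_zero]; exact hfh j
      · intro j
        beta_reduce
        by_cases hj : j = i
        · rw [if_pos hj, map_sub, hcc, cc_pos hα1 one_ne_zero, sub_zero]
        · rw [if_neg hj, sub_zero, hcc]
      · rw [hexp, hrel]
      · rintro ⟨h, -⟩; exact hα0 h
      · intro g x hgx
        obtain ⟨q, hq1, hq2⟩ := hsyz (fun j => g j + if j = i then x else 0) x (by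
          rw [← hexp]
          simpa using hgx)
        refine ⟨q, ?_, hq2⟩
        intro j
        have := hq1 j
        rw [mul_sub, ← this]
        split_ifs
        · rw [← hq2]; ring
        · ring
    refine free_of_const hA hφ R hB0 hd hBd hdvd P2 hi ?_
    rw [rho_add, ht1, h1, zero_add, ← hhi]
  · exfalso
    push Not at hex
    have hz : ∀ i, h i = 0 ∨ d < e i := by
      intro i
      rcases lt_trichotomy (e i) d with hl | hl | hl
      · exact Or.inl (h3 i hl)
      · left
        apply zero_of_cc _ (hex i)
        have := h2 i
        rwa [hl, Nat.sub_self] at this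
      · exact Or.inr hl
    have hz0 : h 0 = 0 := (hz 0).resolve_right (by omega)
    have hmem : ∀ g : MvPolynomial (Fin 2) K, g.IsHomogeneous A.card → ∃ x y, g = x * h 1 + y * h 2 := by
      intro g hg
      obtain ⟨η, hη, -, hη2⟩ := hsurj A.card g (by omega) hg
      obtain ⟨c, x, hcx⟩ := hgen η hη
      rw [hcx, rho_add, rho_sum, rho_smul, ht1] at hη2
      simp only [rho_smul, h1, Fin.sum_univ_three, hz0] at hη2
      refine ⟨R.ρ (c 1), R.ρ (c 2), ?_⟩
      apply mul_left_cancel₀ hB0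
      linear_combination -hη2
    obtain ⟨x, y, hxy⟩ := hmem (X 0 ^ A.card) (isHomogeneous_X_pow _ _)
    obtain ⟨x', y', hxy'⟩ := hmem (X 1 ^ A.card) (isHomogeneous_X_pow _ _)
    have nounit : ∀ i, ¬ IsUnit (h i) := by
      intro i hu
      have := hu.map (constantCoeff (σ := Fin 2) (R := K))
      rw [hex i] at this
      exact not_isUnit_zero this
    rcases hz 1 with hz1 | hz1
    · rw [hz1, mul_zero, zero_add] at hxy hxy'
      exact nounit 2 (X_pow_relPrime (K := K) A.card ⟨y, by rw [hxy, mul_comm]⟩ ⟨y', by rw [hxy', mul_comm]⟩)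
    rcases hz 2 with hz2 | hz2
    · rw [hz2, mul_zero, add_zero] at hxy hxy'
      exact nounit 1 (X_pow_relPrime (K := K) A.card ⟨x, by rw [hxy, mul_comm]⟩ ⟨x', by rw [hxy', mul_comm]⟩)
    have hf0 : ∀ i, d < e i → f i = 0 := by
      intro i hi
      apply zero_of_cc _ (hcc i)
      have := hfh i
      rwa [show d + 1 - e i = 0 by omega] at this
    rw [Fin.sum_univ_three, hf0 1 hz1, hf0 2 hz2, zero_smul, zero_smul, add_zero, add_zero] at hrel
    apply psi_contra hA P' (i := 1) (j := 0) (by decide) (s := 0) (p := f 0) (q := α) hΦ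
    · intro p hp0 hpα
      apply pog_primitive P' _ hpα
      intro i
      fin_cases i
      · exact hp0
      · show p ∣ f 1
        rw [hf0 1 hz1]; exact dvd_zero _
      · show p ∣ f 2
        rw [hf0 2 hz2]; exact dvd_zero _
    · exact hcc 0
    · exact cc_pos hα1 one_ne_zero
    · rw [zero_smul, sub_zero, hrel]



lemma hom_finite (k m : ℕ) : Module.Finite K (homogeneousSubmodule (Fin k) K m) :=
  Module.Finite.iff_fg.2 (homogeneousSubmodule_fg _ _ m)

lemma hom_finrank (k m : ℕ) :
    Module.finrank K (homogeneousSubmodule (Fin k) K m) = (k + m - 1).choose m := by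
  rw [homogeneousSubmodule_eq_finsupp_supported,
    LinearEquiv.finrank_eq (AddMonoidAlgebra.supportedEquivFinsupp _)]
  have hs : {d : Fin k →₀ ℕ | d.degree = m} = ↑(Finset.finsuppAntidiag (Finset.univ : Finset (Fin k)) m) := by
    ext d
    simp [Finsupp.degree_eq_sum]
  rw [hs]
  have h := Finset.card_finsuppAntidiag_nat_eq_choose (s := (Finset.univ : Finset (Fin k))) m
  rw [Finset.card_univ, Fintype.card_fin] at h
  rw [← h]
  have := Module.finrank_finsupp_self (R := K) (ι := (Finset.finsuppAntidiag (Finset.univ : Finset (Fin k)) m))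
  rw [Fintype.card_coe] at this
  exact this

lemma hom2 (m : ℕ) : Module.finrank K (homogeneousSubmodule (Fin 2) K m) = m + 1 := by
  rw [hom_finrank, show 2 + m - 1 = m + 1 by omega, Nat.choose_succ_self_right]

lemma hom3 (m : ℕ) : (2 * Module.finrank K (homogeneousSubmodule (Fin 3) K m) : ℤ) = (m + 2) * (m + 1) := by
  rw [hom_finrank, show 3 + m - 1 = m + 2 by omega, Nat.choose_symm_of_eq_add (b := 2) (by omega)]
  have h := Nat.triangle_succ (m + 1)
  rw [Nat.choose_two_right]
  have h2 : (m + 2) * (m + 2 - 1) / 2 * 2 = (m + 2) * (m + 2 - 1) := by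
    apply Nat.div_mul_cancel
    rw [show m + 2 - 1 = m + 1 by omega, mul_comm]
    exact (Nat.even_mul_succ_self (m + 1)).two_dvd
  have h3 : ((m + 2 : ℕ) : ℤ) * ((m + 2 - 1 : ℕ) : ℤ) = (m + 2) * (m + 1) := by
    rw [show m + 2 - 1 = m + 1 by omega]; push_cast; ring
  rw [← h3]
  exact_mod_cast (by rw [mul_comm]; exact h2)

/-- graded piece of `D(A)`. -/
def Dn (A : Finset (Submodule K (Fin 3 → K))) (n : ℕ) : Submodule K (Deriv K 3) where
  carrier := {θ | θ ∈ DM A ∧ HomogDeriv θ n}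
  add_mem' := fun ha hb => ⟨Submodule.add_mem _ ha.1 hb.1, fun i => (ha.2 i).add (hb.2 i)⟩
  zero_mem' := ⟨Submodule.zero_mem _, fun _ => isHomogeneous_zero _ _ _⟩
  smul_mem' := by
    intro c θ h
    have : c • θ = (C c : MvPolynomial (Fin 3) K) • θ := by
      funext i
      simp [MvPolynomial.smul_eq_C_mul]
    rw [this]
    exact ⟨Submodule.smul_mem _ _ h.1, fun i => (h.2 i).C_mul c⟩

lemma mem_Dn {A : Finset (Submodule K (Fin 3 → K))} {n : ℕ} {θ : Deriv K 3} :
    θ ∈ Dn A n ↔ θ ∈ DM A ∧ HomogDeriv θ n := Iff.rfl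

lemma Dn_empty_range (n : ℕ) : LinearMap.range
    ((homogeneousSubmodule (Fin 3) K n).subtype.compLeft (Fin 3)) = Dn (∅ : Finset (Submodule K (Fin 3 → K))) n := by
  ext θ
  rw [mem_Dn, LinearMap.mem_range]
  constructor
  · rintro ⟨y, rfl⟩
    refine ⟨fun H hH => absurd hH (Finset.notMem_empty _), fun i => ?_⟩
    exact (mem_homogeneousSubmodule _ _).1 (y i).2
  · rintro ⟨-, h⟩
    exact ⟨fun i => ⟨θ i, (mem_homogeneousSubmodule _ _).2 (h i)⟩, rfl⟩

lemma Dn_finite (A : Finset (Submodule K (Fin 3 → K))) (n : ℕ) : Module.Finite K (Dn A n) := by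
  have := hom_finite (K := K) 3 n
  have h1 : Module.Finite K (Dn (∅ : Finset (Submodule K (Fin 3 → K))) n) := by
    rw [← Dn_empty_range]; infer_instance
  apply Submodule.finiteDimensional_of_le (S₂ := Dn (∅ : Finset (Submodule K (Fin 3 → K))) n)
  intro θ hθ
  exact ⟨fun H hH => absurd hH (Finset.notMem_empty _), hθ.2⟩

lemma Dn_empty (n : ℕ) : Module.finrank K (Dn (∅ : Finset (Submodule K (Fin 3 → K))) n)
    = 3 * Module.finrank K (homogeneousSubmodule (Fin 3) K n) := by
  have := hom_finite (K := K) 3 n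
  rw [← Dn_empty_range, LinearMap.finrank_range_of_inj, Module.finrank_pi_fintype]
  · simp
  · intro x y h
    funext i
    exact Subtype.ext (congrFun h i)

lemma rank_nullity {V W : Type} [AddCommGroup V] [Module K V] [AddCommGroup W] [Module K W]
    (f : V →ₗ[K] W) (p : Submodule K V) [Module.Finite K p] :
    Module.finrank K p = Module.finrank K (p.map f) + Module.finrank K (p ⊓ LinearMap.ker f : Submodule K V) := by
  rw [← LinearMap.finrank_range_add_finrank_ker (f.domRestrict p), LinearMap.range_domRestrict,
    LinearMap.ker_domRestrict, ← Submodule.finrank_map_subtype_eq p]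
  rw [Submodule.map_comap_subtype]

lemma hilb_step {A : Finset (Submodule K (Fin 3 → K))} (hA : IsArrangement A)
    {φ : Module.Dual K (Fin 3 → K)} (hφ : φ ≠ 0) (hn : LinearMap.ker φ ∉ A) {n : ℕ} (hnn : 2 * A.card ≤ n) :
    (Module.finrank K (Dn A n) : ℤ) = Module.finrank K (Dn (insert (LinearMap.ker φ) A) n)
      + (n + 1 - A.card + (A.image (fun L => L ⊓ LinearMap.ker φ)).card) := by
  obtain ⟨R⟩ := exists_restr φ hφ
  obtain ⟨B, d, hB0, hBd, hdr, hdvd, hsurj⟩ := key hA hφ hn R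
  have := Dn_finite A n
  set T : Deriv K 3 →ₗ[K] MvPolynomial (Fin 2) K := R.ρ.toLinearMap ∘ₗ (appl φ).restrictScalars K with hT
  have hTa : ∀ θ, T θ = R.ρ (applyLin θ φ) := fun θ => rfl
  have h1 := rank_nullity T (Dn A n)
  have hker : Dn A n ⊓ LinearMap.ker T = Dn (insert (LinearMap.ker φ) A) n := by
    ext θ
    rw [Submodule.mem_inf, mem_Dn, mem_Dn, LinearMap.mem_ker, hTa, test_mem R]
    tauto
  have hmap : (Dn A n).map T = (homogeneousSubmodule (Fin 2) K (n - d)).map (LinearMap.mulLeft K B) := by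
    ext g
    rw [Submodule.mem_map, Submodule.mem_map]
    constructor
    · rintro ⟨θ, hθ, rfl⟩
      obtain ⟨t, ht1, ht2, -⟩ := Bquot hBd (R.hρ _ _ (appl_homog φ hθ.2)) (hdvd _ hθ.1)
      exact ⟨t, (mem_homogeneousSubmodule _ _).2 ht2, by rw [hTa, ht1]; rfl⟩
    · rintro ⟨t, ht, rfl⟩
      obtain ⟨θ, hθ1, hθ2, hθ3⟩ := hsurj (n - d) t (by omega) ((mem_homogeneousSubmodule _ _).1 ht)
      rw [show n - d + d = n by omega] at hθ2
      exact ⟨θ, ⟨hθ1, hθ2⟩, by rw [hTa, hθ3]; rfl⟩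
  have hinj : Function.Injective (LinearMap.mulLeft K B) := fun x y h => mul_left_cancel₀ hB0 h
  rw [hker, hmap, ← LinearEquiv.finrank_eq (Submodule.equivMapOfInjective _ hinj _), hom2] at h1
  rw [h1]
  push_cast
  rw [Nat.cast_sub (by omega)]
  have : (A.card : ℤ) = d + (A.image (fun L => L ⊓ LinearMap.ker φ)).card := by exact_mod_cast hdr.symm
  rw [this]; ring

lemma hilb_spog {A : Finset (Submodule K (Fin 3 → K))} {e : Fin 3 → ℕ} {d n : ℕ}
    (hs : IsSPOG A e d) (hnd : d + 1 ≤ n) (hne : ∀ i, e i ≤ n) :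
    Module.finrank K (Dn A n) + Module.finrank K (homogeneousSubmodule (Fin 3) K (n - d - 1)) =
      (∑ i, Module.finrank K (homogeneousSubmodule (Fin 3) K (n - e i))) +
      Module.finrank K (homogeneousSubmodule (Fin 3) K (n - d)) := by
  obtain ⟨θ, Φ, f, α, ⟨hθ, hΦ, hθh, hΦh, hgen, hα1, hfh, hcc, hrel, -, hsyz⟩, hα0⟩ := hs
  have hfin := hom_finite (K := K) 3
  let T : ((∀ i : Fin 3, homogeneousSubmodule (Fin 3) K (n - e i)) × homogeneousSubmodule (Fin 3) K (n - d))
      →ₗ[K] Deriv K 3 :=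
    { toFun := fun x => ∑ i, (x.1 i : MvPolynomial (Fin 3) K) • θ i + (x.2 : MvPolynomial (Fin 3) K) • Φ
      map_add' := by
        intro x y
        simp only [Prod.fst_add, Prod.snd_add, Pi.add_apply, Submodule.coe_add, add_smul, Finset.sum_add_distrib]
        abel
      map_smul' := by
        intro c x
        simp only [Prod.smul_fst, Prod.smul_snd, Pi.smul_apply, Submodule.coe_smul, smul_assoc, RingHom.id_apply,
          smul_add, Finset.smul_sum] }
  have hTa : ∀ x, T x = ∑ i, (x.1 i : MvPolynomial (Fin 3) K) • θ i + (x.2 : MvPolynomial (Fin 3) K) • Φ :=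
    fun x => rfl
  have hqf : ∀ q : MvPolynomial (Fin 3) K, q.IsHomogeneous (n - d - 1) → ∀ i, (q * f i).IsHomogeneous (n - e i) := by
    intro q hq i
    by_cases h : e i ≤ d + 1
    · have := hq.mul (hfh i)
      rwa [show n - d - 1 + (d + 1 - e i) = n - e i by omega] at this
    · have : f i = 0 := by
        apply zero_of_cc _ (hcc i)
        have := hfh i
        rwa [show d + 1 - e i = 0 by omega] at this
      rw [this, mul_zero]; exact isHomogeneous_zero _ _ _
  have hqα : ∀ q : MvPolynomial (Fin 3) K, q.IsHomogeneous (n - d - 1) → (q * α).IsHomogeneous (n - d) := by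
    intro q hq
    have := hq.mul hα1
    rwa [show n - d - 1 + 1 = n - d by omega] at this
  let J : homogeneousSubmodule (Fin 3) K (n - d - 1) →ₗ[K]
      ((∀ i : Fin 3, homogeneousSubmodule (Fin 3) K (n - e i)) × homogeneousSubmodule (Fin 3) K (n - d)) :=
    { toFun := fun q => (fun i => ⟨q.1 * f i, hqf q.1 q.2 i⟩, ⟨q.1 * α, hqα q.1 q.2⟩)
      map_add' := by
        intro x y
        ext i <;> simp [add_mul]
      map_smul' := by
        intro c x
        ext i <;> simp }
  have hJ : Function.Injective J := by
    intro x y h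
    have := congrArg (fun z => (z.2 : MvPolynomial (Fin 3) K)) h
    exact Subtype.ext (mul_right_cancel₀ hα0 this)
  have hker : LinearMap.ker T = LinearMap.range J := by
    ext x
    rw [LinearMap.mem_ker, LinearMap.mem_range, hTa]
    constructor
    · intro h
      obtain ⟨q, hq1, hq2⟩ := hsyz _ _ h
      have hq : q.IsHomogeneous (n - d - 1) := by
        have h3 : (q * α).IsHomogeneous (n - d) := by rw [← hq2]; exact x.2.2
        have h4 := hc_self h3
        rw [hcs_mul hα1] at h4
        rw [← mul_right_cancel₀ hα0 h4]
        exact hcs_homog _ _ _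
      refine ⟨⟨q, hq⟩, ?_⟩
      apply Prod.ext
      · funext i
        exact Subtype.ext (hq1 i).symm
      · exact Subtype.ext hq2.symm
    · rintro ⟨q, rfl⟩
      have : ∑ i, (q.1 * f i) • θ i + (q.1 * α) • Φ = 0 := by
        simp only [mul_smul, ← Finset.smul_sum]
        rw [← smul_add, hrel, smul_zero]
      exact this
  have hran : LinearMap.range T = Dn A n := by
    ext η
    rw [LinearMap.mem_range, mem_Dn]
    constructor
    · rintro ⟨x, rfl⟩
      rw [hTa]
      constructor
      · exact Submodule.add_mem _ (Submodule.sum_mem _ fun i _ => Submodule.smul_mem _ _ (hθ i))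
          (Submodule.smul_mem _ _ hΦ)
      · intro k
        simp only [Pi.add_apply, Finset.sum_apply, Pi.smul_apply, smul_eq_mul]
        refine (IsHomogeneous.sum _ _ _ fun i _ => ?_).add ?_
        · have := ((mem_homogeneousSubmodule _ _).1 (x.1 i).2).mul (hθh i k)
          rwa [Nat.sub_add_cancel (hne i)] at this
        · have := ((mem_homogeneousSubmodule _ _).1 x.2.2).mul (hΦh k)
          rwa [Nat.sub_add_cancel (by omega)] at this
    · rintro ⟨h1, h2⟩
      obtain ⟨c, g, hcg⟩ := hgen η h1
      refine ⟨(fun i => ⟨hcs n (e i) (c i), hcs_homog _ _ _⟩, ⟨hcs n d g, hcs_homog _ _ _⟩), ?_⟩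
      rw [hTa, ← hcD_self h2, hcg, hcD_add, hcD_sum, hcD_smul hΦh]
      congr 1
      exact Finset.sum_congr rfl fun i _ => (hcD_smul (hθh i) _).symm
  have h1 := LinearMap.finrank_range_add_finrank_ker T
  rw [hker, hran, LinearMap.finrank_range_of_inj hJ, Module.finrank_prod, Module.finrank_pi_fintype] at h1
  exact h1



lemma hyp_finrank {A : Finset (Submodule K (Fin 3 → K))} (hA : IsArrangement A)
    {H : Submodule K (Fin 3 → K)} (hH : H ∈ A) : Module.finrank K H = 2 := by
  obtain ⟨φ, hφ, rfl⟩ := hA H hH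
  have h := LinearMap.finrank_range_add_finrank_ker φ
  rw [LinearMap.range_eq_top.2 (LinearMap.surjective hφ), finrank_top, Module.finrank_self,
    Module.finrank_fin_fun] at h
  omega

lemma inf_finrank {H L : Submodule K (Fin 3 → K)} (hH : Module.finrank K H = 2) (hL : Module.finrank K L = 2)
    (hne : H ≠ L) : Module.finrank K (H ⊓ L : Submodule K (Fin 3 → K)) = 1 := by
  have h := Submodule.finrank_sup_add_finrank_inf_eq H L
  have h1 : Module.finrank K (H ⊔ L : Submodule K (Fin 3 → K)) ≤ 3 := by
    have := Submodule.finrank_le (H ⊔ L : Submodule K (Fin 3 → K))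
    rwa [Module.finrank_fin_fun] at this
  have h2 : 2 < Module.finrank K (H ⊔ L : Submodule K (Fin 3 → K)) := by
    by_contra hcon
    have e1 := Submodule.eq_of_le_of_finrank_le (le_sup_left : H ≤ H ⊔ L) (by omega)
    have e2 := Submodule.eq_of_le_of_finrank_le (le_sup_right : L ≤ H ⊔ L) (by omega)
    exact hne (e1.trans e2.symm)
  omega

lemma mem_lattice {A : Finset (Submodule K (Fin 3 → K))} {X : Submodule K (Fin 3 → K)} :
    X ∈ latticeOf ⊤ A ↔ ∃ B ⊆ A, B.inf id = X := by
  simp [latticeOf]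

lemma top_mem_lattice {A : Finset (Submodule K (Fin 3 → K))} : ⊤ ∈ latticeOf ⊤ A :=
  mem_lattice.2 ⟨∅, by simp, by simp⟩

lemma hyp_mem_lattice {A : Finset (Submodule K (Fin 3 → K))} {H : Submodule K (Fin 3 → K)} (hH : H ∈ A) :
    H ∈ latticeOf ⊤ A :=
  mem_lattice.2 ⟨{H}, by simpa using hH, by simp⟩

lemma lattice_cases {A : Finset (Submodule K (Fin 3 → K))} (hA : IsArrangement A)
    {X : Submodule K (Fin 3 → K)} (hX : X ∈ latticeOf ⊤ A) :
    X = ⊤ ∨ X ∈ A ∨ (Module.finrank K X ≤ 1 ∧ ∃ H ∈ A, ∃ L ∈ A, H ≠ L ∧ X ≤ H ⊓ L) := by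
  obtain ⟨B, hB, rfl⟩ := mem_lattice.1 hX
  rcases B.eq_empty_or_nonempty with rfl | ⟨H, hH⟩
  · left; simp
  · by_cases h : ∃ L ∈ B, H ≠ L
    · obtain ⟨L, hL, hne⟩ := h
      right; right
      have hle : B.inf id ≤ H ⊓ L := le_inf (Finset.inf_le (f := id) hH) (Finset.inf_le (f := id) hL)
      refine ⟨?_, H, hB hH, L, hB hL, hne, hle⟩
      rw [← inf_finrank (hyp_finrank hA (hB hH)) (hyp_finrank hA (hB hL)) hne]
      exact Submodule.finrank_mono hle
    · push Not at h
      right; left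
      have : B = {H} := by
        ext L
        constructor
        · intro hL; simp [h L hL]
        · intro hL; rw [Finset.mem_singleton.1 hL]; exact hH
      rw [this]
      simpa using hB hH

/-- number of hyperplanes through `X` -/
def mult (A : Finset (Submodule K (Fin 3 → K))) (X : Submodule K (Fin 3 → K)) : ℕ :=
  (A.filter (fun L => X ≤ L)).card

lemma mob_top (L : Finset (Submodule K (Fin 3 → K))) : mob ⊤ L ⊤ = 1 := by
  rw [mob, if_pos rfl]

lemma mob_ne (L : Finset (Submodule K (Fin 3 → K))) {X : Submodule K (Fin 3 → K)} (hX : X ≠ ⊤) :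
    mob ⊤ L X = - ∑ Y ∈ L.filter (fun Z => X < Z), mob ⊤ L Y := by
  rw [mob, if_neg hX]
  congr 1
  exact Finset.sum_attach (L.filter (fun Z => X < Z)) (fun Y => mob ⊤ L Y)

lemma ne_top_of_finrank {X : Submodule K (Fin 3 → K)} (h : Module.finrank K X ≤ 2) : X ≠ ⊤ := by
  rintro rfl
  rw [finrank_top, Module.finrank_fin_fun] at h
  omega

lemma mob_hyp {A : Finset (Submodule K (Fin 3 → K))} (hA : IsArrangement A)
    {H : Submodule K (Fin 3 → K)} (hH : H ∈ A) : mob ⊤ (latticeOf ⊤ A) H = -1 := by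
  have h2 := hyp_finrank hA hH
  have hne : H ≠ ⊤ := ne_top_of_finrank h2.le
  rw [mob_ne _ hne]
  have : (latticeOf ⊤ A).filter (fun Z => H < Z) = {⊤} := by
    ext Z
    rw [Finset.mem_filter, Finset.mem_singleton]
    constructor
    · rintro ⟨hZ, hlt⟩
      have := Submodule.finrank_lt_finrank_of_lt hlt
      rcases lattice_cases hA hZ with h | h | h
      · exact h
      · have := hyp_finrank hA h; omega
      · omega
    · rintro rfl
      exact ⟨top_mem_lattice, lt_top_iff_ne_top.2 hne⟩
  rw [this, Finset.sum_singleton, mob_top]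

lemma mob_line {A : Finset (Submodule K (Fin 3 → K))} (hA : IsArrangement A)
    {X : Submodule K (Fin 3 → K)} (hX : Module.finrank K X = 1) :
    mob ⊤ (latticeOf ⊤ A) X = (mult A X : ℤ) - 1 := by
  rw [mob_ne _ (ne_top_of_finrank (by omega))]
  have : (latticeOf ⊤ A).filter (fun Z => X < Z) = insert ⊤ (A.filter (fun L => X ≤ L)) := by
    ext Z
    rw [Finset.mem_filter, Finset.mem_insert, Finset.mem_filter]
    constructor
    · rintro ⟨hZ, hlt⟩
      have := Submodule.finrank_lt_finrank_of_lt hlt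
      rcases lattice_cases hA hZ with h | h | h
      · exact Or.inl h
      · exact Or.inr ⟨h, hlt.le⟩
      · omega
    · rintro (rfl | ⟨hZ, hle⟩)
      · exact ⟨top_mem_lattice, lt_top_iff_ne_top.2 (ne_top_of_finrank (by omega))⟩
      · refine ⟨hyp_mem_lattice hZ, lt_of_le_of_ne hle ?_⟩
        rintro rfl
        have := hyp_finrank hA hZ
        omega
  rw [this, Finset.sum_insert, mob_top, Finset.sum_congr rfl (g := fun _ => (-1 : ℤ))]
  · rw [Finset.sum_const, mult]
    simp; ring
  · intro Y hY
    exact mob_hyp hA (Finset.mem_filter.1 hY).1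
  · intro h
    exact ne_top_of_finrank (hyp_finrank hA (Finset.mem_filter.1 h).1).le rfl

/-- lines in the lattice -/
def lns (A : Finset (Submodule K (Fin 3 → K))) : Finset (Submodule K (Fin 3 → K)) :=
  (latticeOf ⊤ A).filter (fun X => Module.finrank K X = 1)

lemma mem_lns {A : Finset (Submodule K (Fin 3 → K))} (hA : IsArrangement A) {X : Submodule K (Fin 3 → K)} :
    X ∈ lns A ↔ Module.finrank K X = 1 ∧ 2 ≤ mult A X := by
  rw [lns, Finset.mem_filter]
  constructor
  · rintro ⟨h1, h2⟩
    refine ⟨h2, ?_⟩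
    rcases lattice_cases hA h1 with h | h | ⟨-, H, hH, L, hL, hne, hle⟩
    · exact absurd h (ne_top_of_finrank (by omega))
    · have := hyp_finrank hA h; omega
    · rw [mult]
      apply Finset.one_lt_card.2
      exact ⟨H, Finset.mem_filter.2 ⟨hH, hle.trans inf_le_left⟩, L,
        Finset.mem_filter.2 ⟨hL, hle.trans inf_le_right⟩, hne⟩
  · rintro ⟨h1, h2⟩
    refine ⟨?_, h1⟩
    obtain ⟨H, hH, L, hL, hne⟩ := Finset.one_lt_card.1 h2
    rw [Finset.mem_filter] at hH hL
    refine mem_lattice.2 ⟨{H, L}, ?_, ?_⟩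
    · intro Z hZ
      rcases Finset.mem_insert.1 hZ with rfl | hZ
      · exact hH.1
      · rw [Finset.mem_singleton.1 hZ]; exact hL.1
    · rw [Finset.inf_insert, Finset.inf_singleton]
      symm
      apply Submodule.eq_of_le_of_finrank_le (le_inf hH.2 hL.2)
      rw [h1]
      exact (inf_finrank (hyp_finrank hA hH.1) (hyp_finrank hA hL.1) hne).le

lemma bNum_eq {A : Finset (Submodule K (Fin 3 → K))} (hA : IsArrangement A) :
    bNum A 2 = ((∑ X ∈ lns A, (mult A X - 1) : ℕ) : ℤ) := by
  have h : bNum A 2 = ∑ X ∈ latticeOf ⊤ A, if Module.finrank K X = 1 then mob ⊤ (latticeOf ⊤ A) X else 0 := by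
    simp only [bNum, charPoly, Polynomial.finsetSum_coeff, Polynomial.coeff_C_mul, Polynomial.coeff_X_pow]
    rw [show ((-1 : ℤ)) ^ 2 = 1 by norm_num, one_mul]
    apply Finset.sum_congr rfl
    intro X _
    by_cases hX : Module.finrank K X = 1
    · rw [if_pos hX, if_pos (by omega), mul_one]
    · rw [if_neg hX, if_neg (by omega), mul_zero]
  rw [h, ← Finset.sum_filter]
  push_cast
  apply Finset.sum_congr rfl
  intro X hX
  have := (mem_lns hA).1 hX
  rw [mob_line hA this.1, Nat.cast_sub (by omega)]
  simp

lemma bNum_insert {A : Finset (Submodule K (Fin 3 → K))} {H : Submodule K (Fin 3 → K)}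
    (hA : IsArrangement (insert H A)) (hH : H ∉ A) :
    bNum (insert H A) 2 = bNum A 2 + (A.image (fun L => L ⊓ H)).card := by
  have hA' : IsArrangement A := fun L hL => hA L (Finset.mem_insert_of_mem hL)
  have hH2 := hyp_finrank hA (Finset.mem_insert_self H A)
  rw [bNum_eq hA, bNum_eq hA']
  have hm : ∀ X, mult (insert H A) X = mult A X + if X ≤ H then 1 else 0 := by
    intro X
    rw [mult, mult, Finset.filter_insert]
    split_ifs with h
    · rw [Finset.card_insert_of_notMem]
      intro h'
      exact hH (Finset.mem_filter.1 h').1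
    · rfl
  have hsub : lns A ⊆ lns (insert H A) := by
    intro X hX
    rw [mem_lns hA'] at hX
    rw [mem_lns hA]
    exact ⟨hX.1, hX.2.trans (by rw [hm]; omega)⟩
  have himg : (lns (insert H A)).filter (fun X => X ≤ H) = A.image (fun L => L ⊓ H) := by
    ext X
    rw [Finset.mem_filter, mem_lns hA, Finset.mem_image]
    constructor
    · rintro ⟨⟨h1, h2⟩, h3⟩
      rw [hm, if_pos h3] at h2
      obtain ⟨L, hL⟩ := Finset.card_pos.1 (show 0 < mult A X by omega)
      rw [Finset.mem_filter] at hL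
      refine ⟨L, hL.1, ?_⟩
      symm
      apply Submodule.eq_of_le_of_finrank_le (le_inf hL.2 h3)
      rw [h1]
      refine (inf_finrank (hyp_finrank hA' hL.1) hH2 ?_).le
      rintro rfl
      exact hH hL.1
    · rintro ⟨L, hL, rfl⟩
      refine ⟨⟨inf_finrank (hyp_finrank hA' hL) hH2 ?_, ?_⟩, inf_le_right⟩
      · rintro rfl
        exact hH hL
      · rw [hm, if_pos inf_le_right]
        have : 0 < mult A (L ⊓ H) := Finset.card_pos.2 ⟨L, Finset.mem_filter.2 ⟨hL, inf_le_left⟩⟩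
        omega
  rw [← himg, Finset.card_filter]
  have h1 : ∑ X ∈ lns A, (mult A X - 1) = ∑ X ∈ lns (insert H A), (mult A X - 1) := by
    apply Finset.sum_subset hsub
    intro X hX hX'
    have := (mem_lns hA).1 hX
    rw [mem_lns hA'] at hX'
    have : ¬ 2 ≤ mult A X := fun h => hX' ⟨this.1, h⟩
    omega
  rw [h1, ← Nat.cast_add, ← Finset.sum_add_distrib]
  congr 1
  apply Finset.sum_congr rfl
  intro X hX
  have := (mem_lns hA).1 hX
  have h2 := hm X
  split_ifs at h2 ⊢ <;> omega

lemma bNum_empty : bNum (∅ : Finset (Submodule K (Fin 3 → K))) 2 = 0 := by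
  have hA : IsArrangement (∅ : Finset (Submodule K (Fin 3 → K))) := fun H hH => absurd hH (Finset.notMem_empty _)
  rw [bNum_eq hA, Finset.sum_eq_zero]
  · rfl
  · intro X _
    simp [mult]

lemma hilb_formula (A : Finset (Submodule K (Fin 3 → K))) : IsArrangement A →
    ∀ n : ℕ, 2 * A.card ≤ n →
    (2 * Module.finrank K (Dn A n) : ℤ) = 3 * ((n + 2) * (n + 1)) - 2 * A.card * (n + 1)
      + A.card * (A.card - 1) - 2 * bNum A 2 := by
  induction A using Finset.induction with
  | empty =>
    intro _ n _
    rw [Dn_empty, bNum_empty]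
    have := hom3 (K := K) n
    simp
    linarith
  | insert H A hH ih =>
    intro hA n hn
    have hA' : IsArrangement A := fun L hL => hA L (Finset.mem_insert_of_mem hL)
    rw [Finset.card_insert_of_notMem hH] at hn ⊢
    have h1 := ih hA' n (by omega)
    obtain ⟨φ, hφ, hk⟩ := hA H (Finset.mem_insert_self H A)
    have h2 := hilb_step hA' hφ (by rw [hk]; exact hH) (n := n) (by omega)
    rw [hk] at h2
    rw [bNum_insert hA hH]
    push_cast
    linear_combination h1 - 2 * h2

lemma spog_bNum {A : Finset (Submodule K (Fin 3 → K))} (hA : IsArrangement A) {a b d : ℕ}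
    (hs : IsSPOG A ![1, a, b] d) : A.card = a + b ∧ bNum A 2 = a * b + d := by
  have key : ∀ n : ℕ, 2 * A.card + a + b + d + 1 ≤ n →
      (3 * ((n + 2) * (n + 1)) - 2 * A.card * (n + 1) + A.card * (A.card - 1) - 2 * bNum A 2 : ℤ)
      = (n + 1) * n + (n - a + 2) * (n - a + 1) + (n - b + 2) * (n - b + 1) + 2 * (n - d + 1) := by
    intro n hn
    have h := hilb_spog hs (n := n) (by omega) (by
      intro i
      fin_cases i
      · show 1 ≤ n
        omega
      · show a ≤ n
        omega
      · show b ≤ n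
        omega)
    rw [← hilb_formula A hA n (by omega)]
    rw [Fin.sum_univ_three] at h
    have e0 : (![1, a, b] : Fin 3 → ℕ) 0 = 1 := rfl
    have e1 : (![1, a, b] : Fin 3 → ℕ) 1 = a := rfl
    have e2 : (![1, a, b] : Fin 3 → ℕ) 2 = b := rfl
    rw [e0, e1, e2] at h
    have h' : ((Module.finrank K (Dn A n) : ℤ)
        + Module.finrank K (homogeneousSubmodule (Fin 3) K (n - d - 1))) =
      ((Module.finrank K (homogeneousSubmodule (Fin 3) K (n - 1)) : ℤ) +
      Module.finrank K (homogeneousSubmodule (Fin 3) K (n - a)) +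
      Module.finrank K (homogeneousSubmodule (Fin 3) K (n - b))) +
      Module.finrank K (homogeneousSubmodule (Fin 3) K (n - d)) := by exact_mod_cast h
    have c1 := hom3 (K := K) (n - d - 1)
    have c2 := hom3 (K := K) (n - 1)
    have c3 := hom3 (K := K) (n - a)
    have c4 := hom3 (K := K) (n - b)
    have c5 := hom3 (K := K) (n - d)
    rw [show ((n - d - 1 : ℕ) : ℤ) = n - d - 1 by omega] at c1
    rw [show ((n - 1 : ℕ) : ℤ) = n - 1 by omega] at c2
    rw [show ((n - a : ℕ) : ℤ) = n - a by omega] at c3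
    rw [show ((n - b : ℕ) : ℤ) = n - b by omega] at c4
    rw [show ((n - d : ℕ) : ℤ) = n - d by omega] at c5
    linear_combination 2 * h' - c1 + c2 + c3 + c4 + c5
  have k1 := key _ le_rfl
  have k2 := key (2 * A.card + a + b + d + 1 + 1) (by omega)
  set n := 2 * A.card + a + b + d + 1 with hn
  clear_value n
  push_cast at k1 k2
  have hc : (A.card : ℤ) = a + b := by linarith
  refine ⟨by exact_mod_cast hc, ?_⟩
  rw [hc] at k1
  linarith


/-- Theorem `3`, deletion version for planes: let `ℓ = 3`, `H ∈ A`,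
and suppose `A' = A \ {H}` is not free. Then `A` is free with exponents `(1, a, b)` iff
`A'` is strictly plus-one generated with `POexp(A') = (1, a, b)` and level
`d = |A'| - |A^H|`. Moreover, for an SPOG structure with exponents `(1,a,b)` and level
`d'`, the equality `d' = |A'| - |A^H|` is equivalent to `b₂(A) = ab + a + b`. -/
theorem plane_deletion_criterion {K : Type} [Field K]
    (A : Finset (Submodule K (Fin 3 → K)))
    (hA : IsArrangement A) (hEss : Essential A)
    (H : Submodule K (Fin 3 → K)) (hH : H ∈ A)
    (hnf : ¬ IsFree (A.erase H))
    (a b : ℕ)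
    (d : ℕ) (hd : (d : ℤ) = ((A.erase H).card : ℤ) - ((restrict A H).card : ℤ)) :
    (IsFreeExp A ![1, a, b] ↔ IsSPOG (A.erase H) ![1, a, b] d) ∧
    (∀ d' : ℕ, IsSPOG (A.erase H) ![1, a, b] d' →
      (d' = d ↔ bNum A 2 = (a : ℤ) * b + a + b)) := by
  obtain ⟨φ, hφ, hk⟩ := hA H hH
  subst hk
  have hA0 : IsArrangement (A.erase (LinearMap.ker φ)) :=
    fun L hL => hA L (Finset.mem_of_mem_erase hL)
  have hn : LinearMap.ker φ ∉ A.erase (LinearMap.ker φ) := Finset.notMem_erase _ _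
  have hins : insert (LinearMap.ker φ) (A.erase (LinearMap.ker φ)) = A := Finset.insert_erase hH
  obtain ⟨R⟩ := exists_restr φ hφ
  obtain ⟨B, d0, hB0, hBd, hcard, hdvd, hsurj⟩ := key hA0 hφ hn R
  have hd2 : (d : ℤ) = ((A.erase (LinearMap.ker φ)).card : ℤ) -
      (((A.erase (LinearMap.ker φ)).image (fun L => L ⊓ LinearMap.ker φ)).card : ℤ) := hd
  have hdd : d0 = d := by omega
  subst hdd
  refine ⟨⟨fun hf => ?_, fun hs => ?_⟩, fun e hs => ?_⟩
  · rw [← hins] at hf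
    exact free_to_spog hA0 hφ hn R hB0 hBd hdvd hsurj hf hnf
  · have := spog_to_free hA0 hφ R hB0 hBd hdvd hsurj (e := ![1, a, b]) rfl hs
    rwa [hins] at this
  · obtain ⟨h1, h2⟩ := spog_bNum hA0 hs
    have h3 := bNum_insert (by rw [hins]; exact hA) hn
    rw [hins, h2] at h3
    rw [h3]
    constructor
    · rintro rfl
      omega
    · intro h
      omega

end ArrPOG
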